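/- arXiv:2402.07009 — 8 statements merged into one kernel-verified Lean document; each statement's English description precedes it below -/
import Mathlib

section
/- Let Γ be a nontrivial connected simple graph with p ≥ 2 vertices and maximum degree Δ ≥ 1. Then γ_{[3R]}(Γ) ≤ 3p − 3Δ + 1. -/
open SimpleGraph Finset

/-- A triple Roman dominating function (3RDF) on a simple graph `G`:
labels are at most 4; a vertex labeled 0 has a neighbour labeled 4, or a
neighbour labeled 2 and a neighbour labeled 3, or three neighbours labeled 2;
a vertex labeled 1 has a neighbour labeled at least 3 or two neighbours
labeled 2; a vertex labeled 2 has a neighbour labeled at least 2. -/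
def IsTRDF {V : Type*} (G : SimpleGraph V) (h : V → ℕ) : Prop :=
  (∀ v, h v ≤ 4) ∧
  (∀ v, h v = 0 →
    (∃ u, G.Adj v u ∧ h u = 4) ∨
    (∃ u w, G.Adj v u ∧ G.Adj v w ∧ h u = 2 ∧ h w = 3) ∨
    (∃ u w x, G.Adj v u ∧ G.Adj v w ∧ G.Adj v x ∧ u ≠ w ∧ u ≠ x ∧ w ≠ x ∧
      h u = 2 ∧ h w = 2 ∧ h x = 2)) ∧
  (∀ v, h v = 1 →
    (∃ u, G.Adj v u ∧ 3 ≤ h u) ∨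
    (∃ u w, G.Adj v u ∧ G.Adj v w ∧ u ≠ w ∧ h u = 2 ∧ h w = 2)) ∧
  (∀ v, h v = 2 → ∃ u, G.Adj v u ∧ 2 ≤ h u)

/-- The triple Roman domination number: the minimum weight of a 3RDF on `G`. -/
noncomputable def tripleRomanNumber {V : Type*} [Fintype V] (G : SimpleGraph V) : ℕ :=
  sInf {w | ∃ h : V → ℕ, IsTRDF G h ∧ ∑ v, h v = w}

/-- The triple Roman domination number is at most the weight of any 3RDF. -/
theorem IsTRDF.tripleRomanNumber_le {V : Type*} [Fintype V] {G : SimpleGraph V} {h : V → ℕ}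
    (hh : IsTRDF G h) : tripleRomanNumber G ≤ ∑ v, h v :=
  Nat.sInf_le ⟨h, hh, rfl⟩

/-- Label `v` by 4, its neighbours by 0 and every other vertex by 3. -/
def starLabel {V : Type*} [DecidableEq V] (G : SimpleGraph V) [DecidableRel G.Adj] (v u : V) : ℕ :=
  if u = v then 4 else if G.Adj v u then 0 else 3

theorem isTRDF_starLabel {V : Type*} [DecidableEq V] (G : SimpleGraph V) [DecidableRel G.Adj]
    (v : V) : IsTRDF G (starLabel G v) := by
  refine ⟨fun u => ?_, fun u hu => Or.inl ⟨v, ?_, if_pos rfl⟩, fun u hu => ?_, fun u hu => ?_⟩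
  · unfold starLabel
    split_ifs <;> omega
  · unfold starLabel at hu
    split_ifs at hu with _ hadj
    exact hadj.symm
  · unfold starLabel at hu
    split_ifs at hu <;> omega
  · unfold starLabel at hu
    split_ifs at hu <;> omega

theorem sum_starLabel {V : Type*} [Fintype V] [DecidableEq V] (G : SimpleGraph V)
    [DecidableRel G.Adj] (v : V) :
    ∑ u, starLabel G v u + 3 * G.degree v = 3 * Fintype.card V + 1 := by
  have hdeg : 3 * G.degree v = ∑ u, if G.Adj v u then 3 else 0 := by
    rw [← Finset.sum_filter, ← G.neighborFinset_eq_filter, Finset.sum_const,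
      card_neighborFinset_eq_degree, smul_eq_mul, mul_comm]
  have hcard : 3 * Fintype.card V + 1 = ∑ u, (3 + if u = v then 1 else 0) := by
    simp [Finset.sum_add_distrib, mul_comm]
  rw [hdeg, hcard, ← Finset.sum_add_distrib]
  refine Finset.sum_congr rfl fun u _ => ?_
  by_cases huv : u = v
  · simp [starLabel, huv]
  · by_cases hadj : G.Adj v u <;> simp [starLabel, huv, hadj]

/-- If `Γ` is a nontrivial connected graph with `p ≥ 2` vertices and maximum
degree `Δ ≥ 1`, then `γ_[3R](Γ) ≤ 3p - 3Δ + 1`. -/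
theorem tripleRoman_le_of_maxDegree {V : Type*} [Fintype V] (G : SimpleGraph V)
    [DecidableRel G.Adj] (p Δ : ℕ) (hp : Fintype.card V = p) (hΔ : G.maxDegree = Δ)
    (hconn : G.Connected) (hp2 : 2 ≤ p) (hΔ1 : 1 ≤ Δ) :
    (tripleRomanNumber G : ℤ) ≤ 3 * p - 3 * Δ + 1 := by
  classical
  have := hconn.nonempty
  obtain ⟨v, hv⟩ := G.exists_maximal_degree_vertex
  have hle := (isTRDF_starLabel G v).tripleRomanNumber_le
  have hsum := sum_starLabel G v
  omega
end

section
/- Let Γ be a nontrivial connected simple graph of order p with minimum degree δ. Then γ_{[3R]}(Γ) ≤ ⌊(4p/(δ+1))·(ln(3(δ+1)/4) + 1)⌋. -/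
open SimpleGraph Finset

/-- If every element of a finite type is selected independently with probability `q`, then no
element of `T` is selected with probability `(1 - q) ^ #T`. -/
theorem sum_powerset_disjoint_eq_pow {V : Type*} [Fintype V] [DecidableEq V]
    (q : ℝ) (T : Finset V) :
    ∑ S ∈ (univ : Finset V).powerset, (q ^ #S * (1 - q) ^ #(univ \ S)) *
      (if Disjoint S T then 1 else 0) = (1 - q) ^ #T := by
  have key := Finset.prod_add (fun i : V => if i ∈ T then (0 : ℝ) else q) (fun _ => 1 - q) univ
  have hprod : ∏ i : V, ((if i ∈ T then (0 : ℝ) else q) + (1 - q)) = (1 - q) ^ #T := by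
    have hfactor : ∀ i : V, (if i ∈ T then (0 : ℝ) else q) + (1 - q) =
        if i ∈ T then 1 - q else 1 := by
      intro i
      split_ifs <;> ring
    rw [Finset.prod_congr rfl fun i _ => hfactor i, Finset.prod_ite_mem, univ_inter,
      Finset.prod_const]
  rw [← hprod, key]
  refine Finset.sum_congr rfl fun S _ => ?_
  rw [Finset.prod_const]
  split_ifs with hd
  · rw [Finset.prod_congr rfl fun i hi => if_neg (Finset.disjoint_left.mp hd hi),
      Finset.prod_const, mul_one]
  · obtain ⟨i, hiS, hiT⟩ := Finset.not_disjoint_iff.mp hd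
    have hzero : ∏ j ∈ S, (if j ∈ T then (0 : ℝ) else q) = 0 :=
      Finset.prod_eq_zero hiS (if_pos hiT)
    rw [hzero, mul_zero, zero_mul]

/-- Labelling a set `S` with 4 and the vertices not dominated by `S` with 3 gives a 3RDF. -/
theorem tripleRomanNumber_le_of_finset {V : Type*} [Fintype V] [DecidableEq V]
    (G : SimpleGraph V) [DecidableRel G.Adj] (S : Finset V) :
    (tripleRomanNumber G : ℝ) ≤
      ∑ v, (4 * (1 - if Disjoint S {v} then 1 else 0) +
        3 * if Disjoint S (insert v (G.neighborFinset v)) then 1 else 0) := by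
  let h : V → ℕ := fun v => if v ∈ S then 4 else
    if Disjoint S (insert v (G.neighborFinset v)) then 3 else 0
  have hvalues : ∀ v, h v = 0 ∨ h v = 3 ∨ h v = 4 := by
    intro v
    simp only [h]
    split_ifs <;> simp
  have hdom : IsTRDF G h := by
    refine ⟨fun v => ?_, fun v hv => Or.inl ?_, fun v hv => ?_, fun v hv => ?_⟩
    · have := hvalues v
      omega
    · simp only [h] at hv
      split_ifs at hv with hvS hd
      obtain ⟨u, huS, hu⟩ := Finset.not_disjoint_iff.mp hd
      rcases Finset.mem_insert.mp hu with rfl | hu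
      · exact absurd huS hvS
      · exact ⟨u, (G.mem_neighborFinset v u).mp hu, if_pos huS⟩
    · have := hvalues v
      omega
    · have := hvalues v
      omega
  have hle : tripleRomanNumber G ≤ ∑ v, h v := Nat.sInf_le ⟨h, hdom, rfl⟩
  calc (tripleRomanNumber G : ℝ) ≤ ((∑ v, h v : ℕ) : ℝ) := by exact_mod_cast hle
    _ = ∑ v, (h v : ℝ) := Nat.cast_sum _ _
    _ ≤ _ := by
      refine Finset.sum_le_sum fun v _ => ?_
      by_cases hvS : v ∈ S
      · simp only [h, hvS, Finset.disjoint_singleton_right, not_true_eq_false, if_true, if_false]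
        split_ifs <;> norm_num
      · simp only [h, hvS, Finset.disjoint_singleton_right, not_false_eq_true, if_true, if_false]
        split_ifs <;> norm_num

/-- The expected weight of the 3RDF built from a random vertex set bounds the triple Roman
domination number. -/
theorem tripleRomanNumber_le_sum_degree {V : Type*} [Fintype V] (G : SimpleGraph V)
    [DecidableRel G.Adj] {q : ℝ} (hq₀ : 0 ≤ q) (hq₁ : q ≤ 1) :
    (tripleRomanNumber G : ℝ) ≤ ∑ v, (4 * q + 3 * (1 - q) ^ (G.degree v + 1)) := by
  classical
  let w : Finset V → ℝ := fun S => q ^ #S * (1 - q) ^ #(univ \ S)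
  have hw₀ : ∀ S, 0 ≤ w S := fun S =>
    mul_nonneg (pow_nonneg hq₀ _) (pow_nonneg (sub_nonneg.mpr hq₁) _)
  have hw : ∀ T : Finset V, ∑ S ∈ (univ : Finset V).powerset,
      w S * (if Disjoint S T then 1 else 0) = (1 - q) ^ #T := sum_powerset_disjoint_eq_pow q
  have hw₁ : ∑ S ∈ (univ : Finset V).powerset, w S = 1 := by simpa using hw ∅
  calc (tripleRomanNumber G : ℝ)
      = ∑ S ∈ (univ : Finset V).powerset, w S * tripleRomanNumber G := by
        rw [← Finset.sum_mul, hw₁, one_mul]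
    _ ≤ ∑ S ∈ (univ : Finset V).powerset, w S *
          ∑ v, (4 * (1 - if Disjoint S {v} then 1 else 0) +
            3 * if Disjoint S (insert v (G.neighborFinset v)) then 1 else 0) :=
        Finset.sum_le_sum fun S _ =>
          mul_le_mul_of_nonneg_left (tripleRomanNumber_le_of_finset G S) (hw₀ S)
    _ = ∑ v, ∑ S ∈ (univ : Finset V).powerset,
          (4 * (w S - w S * if Disjoint S {v} then 1 else 0) +
            3 * (w S * if Disjoint S (insert v (G.neighborFinset v)) then 1 else 0)) := by
        simp_rw [Finset.mul_sum]
        rw [Finset.sum_comm]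
        refine Finset.sum_congr rfl fun v _ => Finset.sum_congr rfl fun S _ => ?_
        ring
    _ = ∑ v, (4 * q + 3 * (1 - q) ^ (G.degree v + 1)) := by
        refine Finset.sum_congr rfl fun v _ => ?_
        rw [Finset.sum_add_distrib, ← Finset.mul_sum, ← Finset.mul_sum, Finset.sum_sub_distrib,
          hw, hw, hw₁, Finset.card_singleton,
          Finset.card_insert_of_notMem (G.notMem_neighborFinset_self v),
          SimpleGraph.card_neighborFinset_eq_degree]
        ring

/-- Probabilistic upper bound: for a nontrivial connected graph `Γ` of order `p`
with minimum degree `δ`, `γ_[3R](Γ) ≤ ⌊(4p/(δ+1))·(ln(3(δ+1)/4) + 1)⌋`. -/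
theorem tripleRoman_le_probabilistic {V : Type*} [Fintype V] (G : SimpleGraph V)
    [DecidableRel G.Adj] (p δ : ℕ) (hp : Fintype.card V = p) (hδ : G.minDegree = δ)
    (hconn : G.Connected) (hp2 : 2 ≤ p) :
    (tripleRomanNumber G : ℤ) ≤
      ⌊(4 * p / (δ + 1) : ℝ) * (Real.log (3 * (δ + 1) / 4) + 1)⌋ := by
  have : Nontrivial V := Fintype.one_lt_card_iff_nontrivial.mp (by omega)
  have hδ₁ : (1 : ℝ) ≤ δ := by
    have := hconn.preconnected.minDegree_pos_of_nontrivial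
    exact_mod_cast hδ ▸ this
  have hpos : (0 : ℝ) < δ + 1 := by linarith
  set L := Real.log (3 * (δ + 1) / 4) with hL
  have hL₀ : 0 ≤ L := Real.log_nonneg (by linarith)
  have hL₁ : L ≤ δ + 1 := by
    have := Real.log_le_sub_one_of_pos (show (0 : ℝ) < 3 * (δ + 1) / 4 by linarith)
    linarith
  have hq₀ : 0 ≤ L / (δ + 1) := by positivity
  have hq₁ : L / (δ + 1) ≤ 1 := (div_le_one hpos).mpr hL₁
  have hpow : (1 - L / (δ + 1)) ^ (δ + 1) ≤ 4 / (3 * (δ + 1)) := by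
    calc (1 - L / (δ + 1)) ^ (δ + 1) ≤ Real.exp (-(L / (δ + 1))) ^ (δ + 1) :=
          pow_le_pow_left₀ (sub_nonneg.mpr hq₁) (Real.one_sub_le_exp_neg _) _
      _ = Real.exp (-L) := by
          rw [← Real.exp_nat_mul]
          congr 1
          push_cast
          field_simp
      _ = 4 / (3 * (δ + 1)) := by
          rw [Real.exp_neg, hL, Real.exp_log (by linarith), inv_div]
  rw [Int.le_floor, Int.cast_natCast]
  calc (tripleRomanNumber G : ℝ)
      ≤ ∑ v, (4 * (L / (δ + 1)) + 3 * (1 - L / (δ + 1)) ^ (G.degree v + 1)) :=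
        tripleRomanNumber_le_sum_degree G hq₀ hq₁
    _ ≤ ∑ _v : V, (4 * (L / (δ + 1)) + 3 * (4 / (3 * (δ + 1)))) := by
        refine Finset.sum_le_sum fun v _ => ?_
        have hdeg : δ + 1 ≤ G.degree v + 1 := by
          have := G.minDegree_le_degree v
          omega
        have := pow_le_pow_of_le_one (sub_nonneg.mpr hq₁) (sub_le_self 1 hq₀) hdeg
        linarith
    _ = 4 * p / (δ + 1) * (L + 1) := by
        rw [Finset.sum_const, Finset.card_univ, hp, nsmul_eq_mul]
        field_simp
end

section
/- Let ℱ be the family of all trees that can be built from k ≥ 1 disjoint paths P₄ⁱ : v₁ⁱ v₂ⁱ v₃ⁱ v₄ⁱ (1 ≤ i ≤ k) by adding k − 1 edges between the vertices v₂¹, v₂², …, v₂ᵏ so that the resulting graph is a tree. If T ∈ ℱ, then γ_{[3R]}(T) ≥ 7·p(T)/4, where p(T) is the order of T. -/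
open SimpleGraph Finset

/-- The family `ℱ` of trees built from `k ≥ 1` disjoint paths
`P₄ⁱ : v₁ⁱ v₂ⁱ v₃ⁱ v₄ⁱ` by adding `k - 1` edges between the vertices `v₂ⁱ`
so that the resulting graph is a tree.  The vertex `(i, j)` represents
`v_{j+1}ⁱ`, so the middle vertices `v₂ⁱ` are those with second coordinate `1`.
Since a tree on `4k` vertices has `4k - 1` edges and the `k` paths contribute
`3k` of them, exactly `k - 1` edges between middle vertices are added. -/
def InFamilyF {V : Type*} (G : SimpleGraph V) : Prop :=
  ∃ k : ℕ, 1 ≤ k ∧ ∃ e : V ≃ Fin k × Fin 4,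
    G.IsTree ∧
    (∀ (i : Fin k) (j j' : Fin 4), (j : ℕ) + 1 = (j' : ℕ) →
      G.Adj (e.symm (i, j)) (e.symm (i, j'))) ∧
    (∀ u v : V, G.Adj u v →
      ((e u).1 = (e v).1 ∧
        (((e u).2 : ℕ) + 1 = ((e v).2 : ℕ) ∨ ((e v).2 : ℕ) + 1 = ((e u).2 : ℕ))) ∨
      ((e u).1 ≠ (e v).1 ∧ ((e u).2 : ℕ) = 1 ∧ ((e v).2 : ℕ) = 1))

/-- A pendant vertex and its support vertex carry weight at least four, unless the
pendant vertex is labeled 3 and its support vertex 0. -/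
theorem IsTRDF.pendant_add_support {V : Type*} {G : SimpleGraph V} {h : V → ℕ}
    (hh : IsTRDF G h) {u v : V} (huv : ∀ x, G.Adj u x → x = v) :
    4 ≤ h u + h v ∨ (h u = 3 ∧ h v = 0) := by
  obtain ⟨-, h0, h1, h2⟩ := hh
  have h0 := h0 u
  have h1 := h1 u
  have h2 := h2 u
  grind

/-- A path `a b c d` hanging off a graph at its second vertex `b` carries weight at least
seven under every triple Roman dominating function. -/
theorem IsTRDF.seven_le_of_pendant_path {V : Type*} {G : SimpleGraph V} {h : V → ℕ}
    (hh : IsTRDF G h) {a b c d : V} (ha : ∀ x, G.Adj a x → x = b)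
    (hc : ∀ x, G.Adj c x → x = b ∨ x = d) (hd : ∀ x, G.Adj d x → x = c) :
    7 ≤ h a + h b + h c + h d := by
  have hab := hh.pendant_add_support ha
  have hdc := hh.pendant_add_support hd
  by_contra! hlt
  have hb0 : h b = 0 := by omega
  have hc0 : h c = 0 := by omega
  have hd3 : h d = 3 := by omega
  have h0 := hh.2.1 c hc0
  grind

/-- If `T ∈ ℱ`, then `γ_[3R](T) ≥ 7·p(T)/4`. -/
theorem tripleRoman_ge_of_familyF {V : Type*} [Fintype V] (T : SimpleGraph V)
    (hT : InFamilyF T) :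
    (7 * Fintype.card V : ℚ) / 4 ≤ (tripleRomanNumber T : ℚ) := by
  obtain ⟨k, -, e, -, -, hadj⟩ := hT
  have hcard : Fintype.card V = k * 4 := by
    simp [Fintype.card_congr e]
  have hweight : ∀ h : V → ℕ, IsTRDF T h → 7 * k ≤ ∑ v, h v := by
    intro h hh
    have hpath (i : Fin k) : 7 ≤ ∑ j, h (e.symm (i, j)) := by
      have hnbr (j : Fin 4) (hj : (j : ℕ) ≠ 1) (x : V) (hx : T.Adj (e.symm (i, j)) x) :
          ∃ j' : Fin 4, x = e.symm (i, j') ∧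
            ((j : ℕ) + 1 = (j' : ℕ) ∨ (j' : ℕ) + 1 = (j : ℕ)) := by
        have hx' := hadj _ _ hx
        simp only [Equiv.apply_symm_apply] at hx'
        obtain ⟨hi, hjx⟩ | ⟨-, hj1, -⟩ := hx'
        · exact ⟨(e x).2, by rw [hi, Prod.mk.eta, Equiv.symm_apply_apply], hjx⟩
        · exact absurd hj1 hj
      rw [Fin.sum_univ_four]
      apply hh.seven_le_of_pendant_path
      · intro x hx
        obtain ⟨j', rfl, hj'⟩ := hnbr 0 (by decide) x hx
        fin_cases j' <;> simp_all
      · intro x hx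
        obtain ⟨j', rfl, hj'⟩ := hnbr 2 (by decide) x hx
        fin_cases j' <;> simp_all
      · intro x hx
        obtain ⟨j', rfl, hj'⟩ := hnbr 3 (by decide) x hx
        fin_cases j' <;> simp_all
    calc
      7 * k = ∑ _i : Fin k, 7 := by simp [mul_comm]
      _ ≤ ∑ i, ∑ j, h (e.symm (i, j)) := Finset.sum_le_sum fun i _ => hpath i
      _ = ∑ p, h (e.symm p) := (Fintype.sum_prod_type fun p => h (e.symm p)).symm
      _ = ∑ v, h v := Equiv.sum_comp e.symm h
  have hexists : {w | ∃ h : V → ℕ, IsTRDF T h ∧ ∑ v, h v = w}.Nonempty :=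
    ⟨_, fun _ => 3, by simp [IsTRDF], rfl⟩
  obtain ⟨h, hh, hsum⟩ := Nat.sInf_mem hexists
  have hle : 7 * k ≤ tripleRomanNumber T := (hweight h hh).trans_eq hsum
  have hle' : (7 * k : ℚ) ≤ tripleRomanNumber T := by exact_mod_cast hle
  rw [hcard]
  push_cast
  linarith
end

section
/- If T is a tree of order p ≥ 3, then γ_{[3R]}(T) ≤ 7p/4. -/
open SimpleGraph Finset

/-- The condition that a triple Roman dominating function has to satisfy at the vertex `v`. -/
def TRDFAt {V : Type*} (G : SimpleGraph V) (h : V → ℕ) (v : V) : Prop :=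
  h v ≤ 4 ∧
  (h v = 0 →
    (∃ u, G.Adj v u ∧ h u = 4) ∨
    (∃ u w, G.Adj v u ∧ G.Adj v w ∧ h u = 2 ∧ h w = 3) ∨
    (∃ u w x, G.Adj v u ∧ G.Adj v w ∧ G.Adj v x ∧ u ≠ w ∧ u ≠ x ∧ w ≠ x ∧
      h u = 2 ∧ h w = 2 ∧ h x = 2)) ∧
  (h v = 1 →
    (∃ u, G.Adj v u ∧ 3 ≤ h u) ∨
    (∃ u w, G.Adj v u ∧ G.Adj v w ∧ u ≠ w ∧ h u = 2 ∧ h w = 2)) ∧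
  (h v = 2 → ∃ u, G.Adj v u ∧ 2 ≤ h u)

/-- `SpiderAt G c a b X`: the vertex set `X` is spanned by a spider in `G` with centre `c`,
with `a` legs of length one and `b` legs of length two. -/
inductive SpiderAt {V : Type*} [DecidableEq V] (G : SimpleGraph V) (c : V) :
    ℕ → ℕ → Finset V → Prop
  | single : SpiderAt G c 0 0 {c}
  | pendant {a b : ℕ} {X : Finset V} {v : V} (hX : SpiderAt G c a b X) (hv : v ∉ X)
      (hcv : G.Adj c v) : SpiderAt G c (a + 1) b (insert v X)
  | leg {a b : ℕ} {X : Finset V} {m l : V} (hX : SpiderAt G c a b X) (hm : m ∉ X)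
      (hl : l ∉ insert m X) (hcm : G.Adj c m) (hml : G.Adj m l) :
      SpiderAt G c a (b + 1) (insert l (insert m X))

/-- `SpiderTiled G S`: the vertex set `S` is partitioned into spiders of `G` of order at
least three. -/
inductive SpiderTiled {V : Type*} [DecidableEq V] (G : SimpleGraph V) : Finset V → Prop
  | empty : SpiderTiled G ∅
  | union {S X : Finset V} {c : V} {a b : ℕ} (hS : SpiderTiled G S)
      (hX : SpiderAt G c a b X) (h3 : 3 ≤ #X) (hSX : Disjoint S X) : SpiderTiled G (S ∪ X)

section

variable {V : Type*} {G : SimpleGraph V} {h h' : V → ℕ} {v : V}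

theorem TRDFAt.of_adj_four {u : V} (h0 : h v = 0) (huv : G.Adj v u) (hu : h u = 4) :
    TRDFAt G h v :=
  ⟨by omega, fun _ => .inl ⟨u, huv, hu⟩, by omega, by omega⟩

theorem TRDFAt.of_two_three {u w : V} (h0 : h v = 0) (huv : G.Adj v u) (hwv : G.Adj v w)
    (hu : h u = 2) (hw : h w = 3) : TRDFAt G h v :=
  ⟨by omega, fun _ => .inr (.inl ⟨u, w, huv, hwv, hu, hw⟩), by omega, by omega⟩

theorem TRDFAt.of_three_le (h3 : 3 ≤ h v) (h4 : h v ≤ 4) : TRDFAt G h v :=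
  ⟨h4, by omega, by omega, by omega⟩

theorem TRDFAt.of_two {u : V} (h2 : h v = 2) (huv : G.Adj v u) (hu : 2 ≤ h u) :
    TRDFAt G h v :=
  ⟨by omega, by omega, by omega, fun _ => ⟨u, huv, hu⟩⟩

theorem TRDFAt.congr (H : TRDFAt G h v) (hv : h' v = h v)
    (hu : ∀ u, h u ≠ 0 → h' u = h u) : TRDFAt G h' v := by
  obtain ⟨h4, h0, h1, h2⟩ := H
  refine ⟨by omega, fun e => ?_, fun e => ?_, fun e => ?_⟩
  · rcases h0 (by omega) with ⟨u, a, b⟩ | ⟨u, w, a, b, c, d⟩ |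
      ⟨u, w, x, a, b, c, d, e, f, i, j, k⟩
    · exact .inl ⟨u, a, by rw [hu u (by omega), b]⟩
    · exact .inr (.inl ⟨u, w, a, b, by rw [hu u (by omega), c], by rw [hu w (by omega), d]⟩)
    · exact .inr (.inr ⟨u, w, x, a, b, c, d, e, f, by rw [hu u (by omega), i],
        by rw [hu w (by omega), j], by rw [hu x (by omega), k]⟩)
  · rcases h1 (by omega) with ⟨u, a, b⟩ | ⟨u, w, a, b, c, d, e⟩
    · exact .inl ⟨u, a, by rw [hu u (by omega)]; exact b⟩
    · exact .inr ⟨u, w, a, b, c, by rw [hu u (by omega), d], by rw [hu w (by omega), e]⟩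
  · obtain ⟨u, a, b⟩ := h2 (by omega)
    exact ⟨u, a, by rw [hu u (by omega)]; exact b⟩

variable [DecidableEq V]

theorem TRDFAt.update {x : V} {k : ℕ} (H : TRDFAt G h v) (hx : h x = 0) (hvx : v ≠ x) :
    TRDFAt G (Function.update h x k) v := by
  refine H.congr (by simp [hvx]) fun u hu => ?_
  rw [Function.update_of_ne]
  rintro rfl
  exact hu hx

theorem Finset.sum_update_insert {X : Finset V} {x : V} (hx : x ∉ X) (k : ℕ) :
    ∑ u ∈ insert x X, Function.update h x k u = k + ∑ u ∈ X, h u := by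
  rw [Finset.sum_insert hx, Function.update_self]
  congr 1
  refine Finset.sum_congr rfl fun u hu => Function.update_of_ne ?_ _ _
  rintro rfl
  exact hx hu

namespace SpiderAt

variable {c : V} {a b : ℕ} {X : Finset V}

theorem center_mem (H : SpiderAt G c a b X) : c ∈ X := by
  induction H <;> simp [*]

theorem card_eq (H : SpiderAt G c a b X) : #X = 1 + a + 2 * b := by
  induction H with
  | single => simp
  | pendant hX hv _ ih => rw [card_insert_of_notMem hv]; omega
  | leg hX hm hl _ _ ih => rw [card_insert_of_notMem hl, card_insert_of_notMem hm]; omega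

theorem exists_label_center_four (H : SpiderAt G c a b X) :
    ∃ h : V → ℕ, (∀ v ∉ X, h v = 0) ∧ (∀ v ∈ X, TRDFAt G h v) ∧ h c = 4 ∧
      ∑ v ∈ X, h v = 4 + 3 * b := by
  induction H with
  | single =>
    refine ⟨Function.update 0 c 4, fun v hv => ?_, fun v hv => ?_, by simp, by simp⟩
    · rw [Function.update_of_ne (by simpa using hv)]; rfl
    · obtain rfl : v = c := by simpa using hv
      exact .of_three_le (by simp) (by simp)
  | @pendant a b X v hX hv hcv ih =>
    obtain ⟨h, h0, hd, hc, hs⟩ := ih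
    refine ⟨h, fun u hu => h0 u (by simp_all), fun u hu => ?_, hc, ?_⟩
    · rcases Finset.mem_insert.1 hu with rfl | hu
      · exact .of_adj_four (h0 _ hv) hcv.symm hc
      · exact hd u hu
    · rw [Finset.sum_insert hv, h0 v hv, hs, zero_add]
  | @leg a b X m l hX hm hl hcm hml ih =>
    obtain ⟨h, h0, hd, hc, hs⟩ := ih
    have hlX : l ∉ X := fun e => hl (Finset.mem_insert_of_mem e)
    have hlc : c ≠ l := fun e => hlX (e ▸ hX.center_mem)
    refine ⟨Function.update h l 3, fun u hu => ?_, fun u hu => ?_, ?_, ?_⟩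
    · simp only [Finset.mem_insert, not_or] at hu
      rw [Function.update_of_ne hu.1, h0 u hu.2.2]
    · rcases Finset.mem_insert.1 hu with rfl | hu'
      · exact .of_three_le (by simp) (by simp)
      have hul : u ≠ l := fun e => hl (e ▸ hu')
      rcases Finset.mem_insert.1 hu' with rfl | hu'
      · exact (TRDFAt.of_adj_four (h0 _ hm) hcm.symm hc).update (h0 _ hlX) hul
      · exact (hd u hu').update (h0 _ hlX) hul
    · rw [Function.update_of_ne hlc, hc]
    · rw [Finset.sum_update_insert hl, Finset.sum_insert hm, h0 m hm, hs]
      ring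

theorem exists_label_legs_four (H : SpiderAt G c a b X) (ha : a = 0) :
    ∃ h : V → ℕ, (∀ v ∉ X, h v = 0) ∧ (∀ v ∈ X, v ≠ c → TRDFAt G h v) ∧ h c = 0 ∧
      (b ≠ 0 → TRDFAt G h c) ∧ ∑ v ∈ X, h v = 4 * b := by
  induction H with
  | single => exact ⟨0, by simp, by simp, rfl, by simp, by simp⟩
  | pendant => omega
  | @leg a b X m l hX hm hl hcm hml ih =>
    obtain ⟨h, h0, hd, hc, -, hs⟩ := ih ha
    have hlX : l ∉ X := fun e => hl (Finset.mem_insert_of_mem e)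
    have hlm : l ≠ m := fun e => hl (e ▸ Finset.mem_insert_self _ _)
    have hc' : Function.update h m 4 c = 0 := by
      rw [Function.update_of_ne hcm.ne, hc]
    refine ⟨Function.update h m 4, fun u hu => ?_, fun u hu huc => ?_, hc', fun _ => ?_, ?_⟩
    · simp only [Finset.mem_insert, not_or] at hu
      rw [Function.update_of_ne hu.2.1, h0 u hu.2.2]
    · rcases Finset.mem_insert.1 hu with rfl | hu
      · exact .of_adj_four (by rw [Function.update_of_ne hlm, h0 _ hlX]) hml.symm (by simp)
      rcases Finset.mem_insert.1 hu with rfl | hu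
      · exact .of_three_le (by simp) (by simp)
      · exact (hd u hu huc).update (h0 _ hm) fun e => hm (e ▸ hu)
    · exact .of_adj_four hc' hcm (by simp)
    · rw [Finset.sum_insert hl, Function.update_of_ne hlm, h0 l hlX,
        Finset.sum_update_insert hm, hs]
      ring

theorem exists_label_center_two (H : SpiderAt G c a b X) (ha : a = 0) :
    ∃ h : V → ℕ, (∀ v ∉ X, h v = 0) ∧ (∀ v ∈ X, v ≠ c → TRDFAt G h v) ∧ h c = 2 ∧
      (b = 0 → ∑ v ∈ X, h v = 2) ∧
      (b ≠ 0 → TRDFAt G h c ∧ ∑ v ∈ X, h v = 3 * b + 3) := by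
  induction H with
  | single =>
    refine ⟨Function.update 0 c 2, fun v hv => ?_, by simp, by simp, by simp, by simp⟩
    rw [Function.update_of_ne (by simpa using hv)]; rfl
  | pendant => omega
  | @leg a b X m l hX hm hl hcm hml ih =>
    obtain ⟨h, h0, hd, hc, hb0, hb⟩ := ih ha
    have hlX : l ∉ X := fun e => hl (Finset.mem_insert_of_mem e)
    have hlm : l ≠ m := fun e => hl (e ▸ Finset.mem_insert_self _ _)
    have hlc : c ≠ l := fun e => hlX (e ▸ hX.center_mem)
    by_cases h0b : b = 0
    · have hc' : Function.update h m 4 c = 2 := by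
        rw [Function.update_of_ne hcm.ne, hc]
      refine ⟨Function.update h m 4, fun u hu => ?_, fun u hu huc => ?_, hc', by omega,
        fun _ => ⟨?_, ?_⟩⟩
      · simp only [Finset.mem_insert, not_or] at hu
        rw [Function.update_of_ne hu.2.1, h0 u hu.2.2]
      · rcases Finset.mem_insert.1 hu with rfl | hu
        · exact .of_adj_four (by rw [Function.update_of_ne hlm, h0 _ hlX]) hml.symm (by simp)
        rcases Finset.mem_insert.1 hu with rfl | hu
        · exact .of_three_le (by simp) (by simp)
        · exact (hd u hu huc).update (h0 _ hm) fun e => hm (e ▸ hu)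
      · exact .of_two hc' hcm (by simp)
      · rw [Finset.sum_insert hl, Function.update_of_ne hlm, h0 l hlX,
          Finset.sum_update_insert hm, hb0 h0b]
        omega
    · obtain ⟨hcd, hs⟩ := hb h0b
      have hc' : Function.update h l 3 c = 2 := by
        rw [Function.update_of_ne hlc, hc]
      refine ⟨Function.update h l 3, fun u hu => ?_, fun u hu huc => ?_, hc', by omega,
        fun _ => ⟨hcd.update (h0 _ hlX) hlc, ?_⟩⟩
      · simp only [Finset.mem_insert, not_or] at hu
        rw [Function.update_of_ne hu.1, h0 u hu.2.2]
      · rcases Finset.mem_insert.1 hu with rfl | hu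
        · exact .of_three_le (by simp) (by simp)
        rcases Finset.mem_insert.1 hu with rfl | hu
        · exact .of_two_three (by rw [Function.update_of_ne hlm.symm, h0 _ hm]) hcm.symm hml
            hc' (by simp)
        · exact (hd u hu huc).update (h0 _ hlX) fun e => hlX (e ▸ hu)
      · rw [Finset.sum_update_insert hl, Finset.sum_insert hm, h0 m hm, hs]
        ring

/-- A spider of order `n ≥ 3` has a triple Roman dominating function of weight at most
`7 * n / 4`. -/
theorem exists_label (H : SpiderAt G c a b X) (h3 : 3 ≤ #X) :
    ∃ h : V → ℕ, (∀ v ∉ X, h v = 0) ∧ (∀ v ∈ X, TRDFAt G h v) ∧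
      4 * ∑ v ∈ X, h v ≤ 7 * #X := by
  have hcard := H.card_eq
  by_cases ha : a = 0
  · rcases Nat.lt_or_ge b 3 with hb | hb
    · obtain ⟨h, h0, hd, -, hc, hs⟩ := H.exists_label_legs_four ha
      refine ⟨h, h0, fun v hv => ?_, by omega⟩
      by_cases hvc : v = c
      · exact hvc ▸ hc (by omega)
      · exact hd v hv hvc
    · obtain ⟨h, h0, hd, -, -, hb'⟩ := H.exists_label_center_two ha
      obtain ⟨hc, hs⟩ := hb' (by omega)
      refine ⟨h, h0, fun v hv => ?_, by omega⟩
      by_cases hvc : v = c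
      · exact hvc ▸ hc
      · exact hd v hv hvc
  · obtain ⟨h, h0, hd, -, hs⟩ := H.exists_label_center_four
    exact ⟨h, h0, hd, by omega⟩

/-- Adding a new leaf to a spider yields a spider with the same centre, or the disjoint union
of such a spider and of a spider of order at least three with an adjacent centre. -/
theorem insert_leaf (H : SpiderAt G c a b X) {u : V} (hu : u ∈ X) (hv : v ∉ X)
    (huv : G.Adj u v) :
    (∃ a' b', SpiderAt G c a' b' (insert v X)) ∨
    ∃ A B m a₁ b₁ a₂ b₂, insert v X = A ∪ B ∧ Disjoint A B ∧ SpiderAt G c a₁ b₁ A ∧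
      SpiderAt G m a₂ b₂ B ∧ 3 ≤ #B ∧ G.Adj c m := by
  induction H with
  | single =>
    obtain rfl : u = c := by simpa using hu
    exact .inl ⟨_, _, .pendant .single hv huv⟩
  | @pendant a b X p hX hp hcp ih =>
    simp only [Finset.mem_insert, not_or] at hu hv
    rcases hu with rfl | hu
    · exact .inl ⟨_, _, .leg hX hp (by simp [hv]) hcp huv⟩
    rcases ih hu hv.2 with ⟨a', b', h'⟩ | ⟨A, B, m, a₁, b₁, a₂, b₂, e, hd, hA, hB, h3, hcm⟩
    · refine .inl ⟨a' + 1, b', ?_⟩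
      rw [Finset.insert_comm]
      exact .pendant h' (by simp [hp, Ne.symm hv.1]) hcp
    · have hpe : p ∉ A ∪ B := by rw [← e]; simp [hp, Ne.symm hv.1]
      simp only [Finset.mem_union, not_or] at hpe
      exact .inr ⟨insert p A, B, m, _, _, _, _, by
        rw [Finset.insert_comm, e, Finset.insert_union], by simp [hpe, hd],
        .pendant hA hpe.1 hcp, hB, h3, hcm⟩
  | @leg a b X m l hX hm hl hcm hml ih =>
    have hlm : l ≠ m := fun e => hl (e ▸ Finset.mem_insert_self _ _)
    simp only [Finset.mem_insert, not_or] at hu hv hl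
    have hdis : Disjoint X {v, l, m} := by simp [hv, hl, hm]
    have heq : insert v (insert l (insert m X)) = X ∪ {v, l, m} := by grind
    have hcard : 3 ≤ #({v, l, m} : Finset V) := by
      rw [Finset.card_eq_three.2 ⟨v, l, m, hv.1, hv.2.1, hlm, rfl⟩]
    rcases hu with rfl | rfl | hu
    · exact .inr ⟨X, {v, u, m}, m, _, _, _, _, heq, hdis, hX,
        .leg .single (by simpa using hlm) (by simp [hv]) hml huv, hcard, hcm⟩
    · exact .inr ⟨X, {v, l, u}, u, _, _, _, _, heq, hdis, hX,
        .pendant (.pendant .single (by simpa using hlm) hml) (by simp [hv]) huv, hcard, hcm⟩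
    rcases ih hu hv.2.2 with
      ⟨a', b', h'⟩ | ⟨A, B, m', a₁, b₁, a₂, b₂, e, hd, hA, hB, h3, hcm'⟩
    · refine .inl ⟨a', b' + 1, ?_⟩
      rw [Finset.insert_comm v l, Finset.insert_comm v m]
      exact .leg h' (by simp [hm, Ne.symm hv.2.1]) (by simp [hl, Ne.symm hv.1]) hcm hml
    · have hme : m ∉ A ∪ B := by rw [← e]; simp [hm, Ne.symm hv.2.1]
      have hle : l ∉ A ∪ B := by rw [← e]; simp [hl, Ne.symm hv.1]
      simp only [Finset.mem_union, not_or] at hme hle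
      refine .inr ⟨insert l (insert m A), B, m', _, _, _, _, ?_, by simp [hme, hle, hd],
        .leg hA hme.1 (by simp [hle, hlm]) hcm hml, hB, h3, hcm'⟩
      rw [Finset.insert_comm v l, Finset.insert_comm v m, e, Finset.insert_union,
        Finset.insert_union]

/-- A spider of order at most two can be attached as a leg to the centre of another spider. -/
theorem union_small {m : V} {a' b' : ℕ} {B : Finset V} (H : SpiderAt G c a b X) (hX : #X < 3)
    (hB : SpiderAt G m a' b' B) (hd : Disjoint X B) (hmc : G.Adj m c) :
    ∃ a'' b'', SpiderAt G m a'' b'' (X ∪ B) := by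
  have hcard := H.card_eq
  cases H with
  | single => exact ⟨_, _, .pendant hB (by simpa using hd) hmc⟩
  | @pendant a b Y p hY hp hcp =>
    cases hY with
    | single =>
      refine ⟨a', b' + 1, ?_⟩
      simp only [Finset.disjoint_insert_left, Finset.disjoint_singleton_left] at hd
      rw [Finset.insert_union, Finset.singleton_union]
      exact .leg hB hd.2 (by simp_all) hmc hcp
    | pendant => omega
    | leg => omega
  | leg => omega

end SpiderAt

namespace SpiderTiled

variable {S : Finset V}

theorem of_spiderAt {c : V} {a b : ℕ} (H : SpiderAt G c a b S) (h3 : 3 ≤ #S) :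
    SpiderTiled G S := by
  simpa using SpiderTiled.empty.union H h3 (Finset.disjoint_empty_left _)

theorem insert_leaf (H : SpiderTiled G S) {u : V} (hu : u ∈ S) (hv : v ∉ S)
    (huv : G.Adj u v) : SpiderTiled G (insert v S) := by
  induction H with
  | empty => simp at hu
  | @union S X c a b hS hX h3 hSX ih =>
    simp only [Finset.mem_union, not_or] at hu hv
    by_cases huS : u ∈ S
    · rw [← Finset.insert_union]
      exact (ih huS hv.1).union hX h3 (by simp [hv, hSX])
    rw [← Finset.union_insert]
    have hdis : Disjoint S (insert v X) := by simp [hv, hSX]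
    have h3' : 3 ≤ #(insert v X) := h3.trans (Finset.card_le_card (Finset.subset_insert _ _))
    rcases hX.insert_leaf (hu.resolve_left huS) hv.2 huv with
      ⟨a', b', h'⟩ | ⟨A, B, m, a₁, b₁, a₂, b₂, e, hd, hA, hB, hB3, hcm⟩
    · exact hS.union h' h3' hdis
    rw [e] at hdis ⊢
    by_cases hA3 : 3 ≤ #A
    · rw [← Finset.union_assoc]
      rw [Finset.disjoint_union_right] at hdis
      exact (hS.union hA hA3 hdis.1).union hB hB3 (by simp [hd, hdis])
    · obtain ⟨a', b', h'⟩ := hA.union_small (not_le.1 hA3) hB hd hcm.symm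
      exact hS.union h' (e ▸ h3') hdis

theorem exists_label (H : SpiderTiled G S) :
    ∃ h : V → ℕ, (∀ v ∉ S, h v = 0) ∧ (∀ v ∈ S, TRDFAt G h v) ∧
      4 * ∑ v ∈ S, h v ≤ 7 * #S := by
  induction H with
  | empty => exact ⟨0, by simp⟩
  | @union S X c a b hS hX h3 hSX ih =>
    obtain ⟨h₁, hz₁, hd₁, hs₁⟩ := ih
    obtain ⟨h₂, hz₂, hd₂, hs₂⟩ := hX.exists_label h3
    have hz₂' : ∀ v ∈ S, h₂ v = 0 := fun v hv => hz₂ v (Finset.disjoint_left.1 hSX hv)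
    have hz₁' : ∀ v ∈ X, h₁ v = 0 := fun v hv => hz₁ v (Finset.disjoint_right.1 hSX hv)
    have e₁ : ∀ v ∈ S, (h₁ + h₂) v = h₁ v := fun v hv => by simp [hz₂' v hv]
    have e₂ : ∀ v ∈ X, (h₁ + h₂) v = h₂ v := fun v hv => by simp [hz₁' v hv]
    refine ⟨h₁ + h₂, fun v hv => ?_, fun v hv => ?_, ?_⟩
    · simp only [Finset.mem_union, not_or] at hv
      simp [hz₁ v hv.1, hz₂ v hv.2]
    · rcases Finset.mem_union.1 hv with hv | hv
      · exact (hd₁ v hv).congr (e₁ v hv) fun u hu => e₁ u (not_imp_comm.1 (hz₁ u) hu)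
      · exact (hd₂ v hv).congr (e₂ v hv) fun u hu => e₂ u (not_imp_comm.1 (hz₂ u) hu)
    · rw [Finset.sum_union hSX, Finset.card_union_of_disjoint hSX,
        Finset.sum_congr rfl e₁, Finset.sum_congr rfl e₂, mul_add, mul_add]
      exact Nat.add_le_add hs₁ hs₂

end SpiderTiled

/-- The vertex set of a connected graph of order at least three is tiled by spiders of order at
least three. -/
theorem SimpleGraph.Connected.spiderTiled_univ [Fintype V] (hG : G.Connected)
    (h3 : 3 ≤ Fintype.card V) : SpiderTiled G Finset.univ := by
  let P : Finset V → Prop := fun S =>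
    S.Nonempty ∧ (SpiderTiled G S ∨ ∃ c a b, SpiderAt G c a b S)
  obtain ⟨r⟩ := hG.nonempty
  obtain ⟨S, -, hS⟩ := (Set.toFinite {S | P S}).exists_le_maximal
    (a := {r}) ⟨by simp, .inr ⟨r, 0, 0, .single⟩⟩
  obtain ⟨⟨x, hx⟩, hT⟩ := hS.prop
  have hU : S = Finset.univ := by
    by_contra hne
    obtain ⟨y, hy⟩ : ∃ y, y ∉ S := by simpa [Finset.eq_univ_iff_forall] using hne
    obtain ⟨w⟩ := hG.preconnected x y
    obtain ⟨d, -, hu, hv⟩ := w.exists_boundary_dart (S : Set V) hx hy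
    simp only [Finset.mem_coe] at hu hv
    have key : P (insert d.snd S) := by
      refine ⟨Finset.insert_nonempty _ _, ?_⟩
      rcases hT with hT | ⟨c, a, b, hT⟩
      · exact .inl (hT.insert_leaf hu hv d.adj)
      rcases hT.insert_leaf hu hv d.adj with
        ⟨a', b', h'⟩ | ⟨A, B, m, a₁, b₁, a₂, b₂, e, hd, hA, hB, hB3, hcm⟩
      · exact .inr ⟨c, a', b', h'⟩
      rw [e]
      by_cases hA3 : 3 ≤ #A
      · exact .inl ((SpiderTiled.of_spiderAt hA hA3).union hB hB3 hd)
      · exact .inr ⟨m, hA.union_small (not_le.1 hA3) hB hd hcm.symm⟩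
    exact hv (hS.le_of_ge key (Finset.subset_insert _ _) (Finset.mem_insert_self _ _))
  subst hU
  rcases hT with hT | ⟨c, a, b, hT⟩
  · exact hT
  · exact .of_spiderAt hT h3

end

/-- If `T` is a tree of order `p ≥ 3`, then `γ_[3R](T) ≤ 7p/4`. -/
theorem tripleRoman_tree_le {V : Type*} [Fintype V] (T : SimpleGraph V) (p : ℕ)
    (hp : Fintype.card V = p) (htree : T.IsTree) (hp3 : 3 ≤ p) :
    (tripleRomanNumber T : ℚ) ≤ 7 * p / 4 := by
  classical
  obtain ⟨h, -, hd, hs⟩ := (htree.connected.spiderTiled_univ (by omega)).exists_label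
  have hT : IsTRDF T h :=
    ⟨fun v => (hd v (mem_univ v)).1, fun v => (hd v (mem_univ v)).2.1,
      fun v => (hd v (mem_univ v)).2.2.1, fun v => (hd v (mem_univ v)).2.2.2⟩
  have hle : tripleRomanNumber T ≤ ∑ v, h v := Nat.sInf_le ⟨h, hT, rfl⟩
  have hle' : 4 * tripleRomanNumber T ≤ 7 * p := by
    rw [Finset.card_univ, hp] at hs
    omega
  rw [le_div_iff₀ (by norm_num), mul_comm]
  exact_mod_cast hle'
end

section
/- Let T be a tree of order p ≥ 3 and let ℱ be the family of all trees that can be built from k ≥ 1 disjoint paths P₄ⁱ : v₁ⁱ v₂ⁱ v₃ⁱ v₄ⁱ (1 ≤ i ≤ k) by adding k − 1 edges between the vertices v₂¹, v₂², …, v₂ᵏ so that the resulting graph is a tree. Then γ_{[3R]}(T) = 7p/4 if and only if T ∈ ℱ. -/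
open SimpleGraph Finset

/-- A labelling with values in `{0, 2, 3, 4}` satisfies the domination condition at `v`. -/
def IsDominatedAt {V : Type*} (G : SimpleGraph V) (h : V → ℕ) (v : V) : Prop :=
  (h v = 0 ∧ ((∃ u, G.Adj v u ∧ h u = 4) ∨
    ∃ u w, G.Adj v u ∧ G.Adj v w ∧ h u = 2 ∧ h w = 3)) ∨
  (h v = 2 ∧ ∃ u, G.Adj v u ∧ h u = 4) ∨ h v = 3 ∨ h v = 4

/-- There is a labelling of weight `n` supported on `S` which dominates `S`. -/
def HasLabelling {V : Type*} (G : SimpleGraph V) (S : Finset V) (n : ℕ) : Prop :=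
  ∃ h : V → ℕ, (∀ v ∉ S, h v = 0) ∧ (∀ v ∈ S, IsDominatedAt G h v) ∧ ∑ v ∈ S, h v = n

/-- `S` is dominated by a labelling of weight less than `7 * #S / 4`. -/
def IsCheap {V : Type*} (G : SimpleGraph V) (S : Finset V) : Prop :=
  ∃ n, HasLabelling G S n ∧ 4 * n < 7 * #S

/-- A spider with centre `c`, inner vertices `N` and outer vertices `L`, where every inner vertex
has at most one outer vertex, which is joined to it via `p`. -/
structure IsSpider {V : Type*} (G : SimpleGraph V) (c : V) (N L : Finset V) (p : V → V) :
    Prop where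
  center_notMem_inner : c ∉ N
  center_notMem_outer : c ∉ L
  disjoint : Disjoint N L
  adj_inner : ∀ n ∈ N, G.Adj c n
  map_outer : ∀ l ∈ L, p l ∈ N
  adj_outer : ∀ l ∈ L, G.Adj l (p l)
  injOn : Set.InjOn p L
  one_le : 1 ≤ #N
  two_le : 2 ≤ #N + #L

/-- The paths `f i 0, f i 1, f i 2, f i 3` for `i ∈ C` partition `S`. -/
structure IsPathPartition {V : Type*} (G : SimpleGraph V) (C : Finset V) (f : V → Fin 4 → V)
    (S : Finset V) : Prop where
  inj : ∀ i ∈ C, ∀ j ∈ C, ∀ a b, f i a = f j b → i = j ∧ a = b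
  mem_iff : ∀ v, v ∈ S ↔ ∃ i ∈ C, ∃ a, f i a = v
  adj01 : ∀ i ∈ C, G.Adj (f i 0) (f i 1)
  adj12 : ∀ i ∈ C, G.Adj (f i 1) (f i 2)
  adj23 : ∀ i ∈ C, G.Adj (f i 2) (f i 3)

/-- A partition of `S` into paths such that edges between different paths join their second
vertices, where each path is indexed by its second vertex. -/
structure IsCenteredPartition {V : Type*} (G : SimpleGraph V) (C : Finset V) (f : V → Fin 4 → V)
    (S : Finset V) : Prop extends IsPathPartition G C f S where
  center : ∀ i ∈ C, f i 1 = i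
  cross : ∀ i ∈ C, ∀ j ∈ C, i ≠ j → ∀ a b, G.Adj (f i a) (f j b) → a = 1

/-- `G` is a tree rooted at `r` with parent function `par` and depth function `d`. -/
structure IsRooted {V : Type*} (G : SimpleGraph V) (r : V) (par : V → V) (d : V → ℕ) : Prop where
  par_root : par r = r
  depth_root : d r = 0
  adj_par : ∀ v, v ≠ r → G.Adj v (par v)
  depth_par : ∀ v, v ≠ r → d v = d (par v) + 1
  par_eq_or : ∀ u v, G.Adj u v → par u = v ∨ par v = u

section Labelling

variable {V : Type*} {G : SimpleGraph V}

lemma IsDominatedAt.congr {h h' : V → ℕ} {v : V} (hv : IsDominatedAt G h v) (heq : h' v = h v)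
    (hle : ∀ u, h u ≠ 0 → h' u = h u) : IsDominatedAt G h' v := by
  unfold IsDominatedAt at *
  rw [heq]
  rcases hv with ⟨h0, ⟨u, hu, hu4⟩ | ⟨u, w, hu, hw, hu2, hw3⟩⟩ | ⟨h2, u, hu, hu4⟩ | h3
  · exact .inl ⟨h0, .inl ⟨u, hu, by rw [hle u (by lia), hu4]⟩⟩
  · exact .inl ⟨h0, .inr ⟨u, w, hu, hw, by rw [hle u (by lia), hu2], by rw [hle w (by lia), hw3]⟩⟩
  · exact .inr (.inl ⟨h2, u, hu, by rw [hle u (by lia), hu4]⟩)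
  · exact .inr (.inr h3)

lemma HasLabelling.union [DecidableEq V] {S S' : Finset V} {n m : ℕ} (hS : HasLabelling G S n)
    (hS' : HasLabelling G S' m) (hdisj : Disjoint S S') : HasLabelling G (S ∪ S') (n + m) := by
  obtain ⟨h, h0, hd, rfl⟩ := hS
  obtain ⟨h', h0', hd', rfl⟩ := hS'
  have hS' : ∀ v ∈ S', v ∉ S := fun v hv hv' => Finset.disjoint_left.1 hdisj hv' hv
  refine ⟨fun v => h v + h' v, fun v hv => ?_, fun v hv => ?_, ?_⟩
  · grind
  · rcases Finset.mem_union.1 hv with hv | hv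
    · exact (hd v hv).congr (by grind) (by grind)
    · exact (hd' v hv).congr (by grind) (by grind)
  · rw [Finset.sum_union hdisj]
    congr 1 <;> refine Finset.sum_congr rfl fun v hv => ?_ <;> grind

lemma HasLabelling.exists_isTRDF [Fintype V] {n : ℕ} (hn : HasLabelling G univ n) :
    ∃ h : V → ℕ, IsTRDF G h ∧ ∑ v, h v = n := by
  obtain ⟨h, -, hd, hsum⟩ := hn
  refine ⟨h, ⟨fun v => ?_, fun v hv => ?_, fun v hv => ?_, fun v hv => ?_⟩, hsum⟩ <;>
    rcases hd v (mem_univ v) with ⟨h0, h1 | h1⟩ | ⟨h2, u, hu, hu4⟩ | h3 | h3 <;> try lia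
  · exact .inl h1
  · exact .inr (.inl h1)
  · exact ⟨u, hu, by lia⟩

lemma HasLabelling.tripleRomanNumber_le [Fintype V] {n : ℕ} (hn : HasLabelling G univ n) :
    tripleRomanNumber G ≤ n :=
  Nat.sInf_le hn.exists_isTRDF

end Labelling

namespace IsSpider

variable {V : Type*} {G : SimpleGraph V} {c : V} {N L : Finset V} {p : V → V}

lemma card_outer_le (hs : IsSpider G c N L p) : #L ≤ #N :=
  Finset.card_le_card_of_injOn p hs.map_outer hs.injOn

lemma exists_outer_eq (hs : IsSpider G c N L p) (hcard : #L = #N) {n : V} (hn : n ∈ N) :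
    ∃ l ∈ L, p l = n :=
  Finset.surjOn_of_injOn_of_card_le p hs.map_outer hs.injOn hcard.ge hn

variable [DecidableEq V]

lemma sum_eq (hs : IsSpider G c N L p) (h : V → ℕ) :
    ∑ v ∈ insert c (N ∪ L), h v = h c + (∑ v ∈ N, h v + ∑ v ∈ L, h v) := by
  rw [Finset.sum_insert (by simp [hs.center_notMem_inner, hs.center_notMem_outer]),
    Finset.sum_union hs.disjoint]

lemma card_eq (hs : IsSpider G c N L p) : #(insert c (N ∪ L)) = 1 + (#N + #L) := by
  simpa using hs.sum_eq 1

lemma hasLabelling_center (hs : IsSpider G c N L p) :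
    HasLabelling G (insert c (N ∪ L)) (4 + 3 * #L) := by
  have hcN := hs.center_notMem_inner
  have hcL := hs.center_notMem_outer
  have hNL := Finset.disjoint_left.1 hs.disjoint
  refine ⟨fun v => if v = c then 4 else if v ∈ L then 3 else 0, ?_, ?_, ?_⟩
  · grind
  · intro v hv
    simp only [Finset.mem_insert, Finset.mem_union] at hv
    rcases hv with rfl | hv | hv
    · simp [IsDominatedAt]
    · exact .inl ⟨by grind, .inl ⟨c, (hs.adj_inner v hv).symm, by simp⟩⟩
    · exact .inr (.inr (.inl (by grind)))
  · rw [hs.sum_eq, Finset.sum_congr rfl (g := fun _ => 0) (s₁ := N) (by grind),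
      Finset.sum_congr rfl (g := fun _ => 3) (s₁ := L) (by grind)]
    simp [mul_comm]

lemma hasLabelling_inner (hs : IsSpider G c N L p) :
    HasLabelling G (insert c (N ∪ L)) (4 * #N) := by
  have hcN := hs.center_notMem_inner
  have hNL := Finset.disjoint_left.1 hs.disjoint
  refine ⟨fun v => if v ∈ N then 4 else 0, ?_, ?_, ?_⟩
  · grind
  · intro v hv
    simp only [Finset.mem_insert, Finset.mem_union] at hv
    rcases hv with rfl | hv | hv
    · obtain ⟨n, hn⟩ := Finset.card_pos.1 hs.one_le
      exact .inl ⟨by grind, .inl ⟨n, hs.adj_inner n hn, by grind⟩⟩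
    · simp [IsDominatedAt, hv]
    · exact .inl ⟨by grind, .inl ⟨p v, hs.adj_outer v hv, by grind [hs.map_outer v hv]⟩⟩
  · rw [hs.sum_eq, Finset.sum_congr rfl (g := fun _ => 4) (s₁ := N) (by grind),
      Finset.sum_congr rfl (g := fun _ => 0) (s₁ := L) (by grind)]
    simp [hcN, mul_comm]

lemma hasLabelling_mixed (hs : IsSpider G c N L p) (hcard : #L = #N) :
    HasLabelling G (insert c (N ∪ L)) (3 * #L + 3) := by
  have hcN := hs.center_notMem_inner
  have hcL := hs.center_notMem_outer
  have hNL := Finset.disjoint_left.1 hs.disjoint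
  have hone := hs.one_le
  obtain ⟨l, hl⟩ := Finset.card_pos.1 (hcard ▸ hone)
  have hpl := hs.map_outer l hl
  refine ⟨fun v => if v = c then 2 else if v = p l then 4 else if v = l then 0 else
    if v ∈ L then 3 else 0, ?_, ?_, ?_⟩
  · grind
  · intro v hv
    simp only [Finset.mem_insert, Finset.mem_union] at hv
    rcases hv with rfl | hv | hv
    · exact .inr (.inl ⟨by simp, p l, hs.adj_inner _ hpl, by grind⟩)
    · by_cases hvl : v = p l
      · exact .inr (.inr (.inr (by grind)))
      · obtain ⟨m, hm, rfl⟩ := hs.exists_outer_eq hcard hv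
        exact .inl ⟨by grind, .inr ⟨c, m, (hs.adj_inner _ hv).symm, (hs.adj_outer m hm).symm,
          by simp, by grind⟩⟩
    · by_cases hvl : v = l
      · exact .inl ⟨by grind, .inl ⟨p l, hvl ▸ hs.adj_outer l hl, by grind⟩⟩
      · exact .inr (.inr (.inl (by grind)))
  · rw [hs.sum_eq, Finset.sum_congr rfl (g := fun v => if v = p l then 4 else 0) (s₁ := N)
      (by grind), ← Finset.add_sum_erase L _ hl,
      Finset.sum_congr rfl (g := fun _ => 3) (s₁ := L.erase l) (by grind)]
    have : l ≠ c := by grind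
    have : l ≠ p l := by grind
    simp [*, Finset.card_erase_of_mem hl]
    lia

lemma isCheap_or (hs : IsSpider G c N L p) :
    IsCheap G (insert c (N ∪ L)) ∨
      (HasLabelling G (insert c (N ∪ L)) 7 ∧ #N = 2 ∧ #L = 1) := by
  have h1 := hs.one_le
  have h2 := hs.two_le
  have hle := hs.card_outer_le
  have hcard := hs.card_eq
  rcases hle.eq_or_lt with heq | hlt
  · left
    rcases le_or_gt #L 2 with h | h
    · exact ⟨_, hs.hasLabelling_inner, by lia⟩
    · exact ⟨_, hs.hasLabelling_mixed heq, by lia⟩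
  · by_cases h : #N = 2 ∧ #L = 1
    · exact .inr ⟨by simpa [h.2] using hs.hasLabelling_center, h⟩
    · exact .inl ⟨_, hs.hasLabelling_center, by lia⟩

/-- A spider with one leg of length one and one leg of length two is a path. -/
lemma exists_path (hs : IsSpider G c N L p) (hN : #N = 2) (hL : #L = 1) :
    ∃ x y z, insert c (N ∪ L) = {x, c, y, z} ∧ G.Adj x c ∧ G.Adj c y ∧ G.Adj y z ∧
      [x, c, y, z].Nodup := by
  obtain ⟨z, rfl⟩ := Finset.card_eq_one.1 hL
  have hy := hs.map_outer z (by simp)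
  obtain ⟨x, hx⟩ := Finset.card_eq_one.1
    (show #(N.erase (p z)) = 1 by rw [Finset.card_erase_of_mem hy, hN])
  have hxN : x ∈ N.erase (p z) := by simp [hx]
  have hNeq : N = {x, p z} := by rw [← Finset.insert_erase hy, hx, Finset.pair_comm]
  have hcN := hs.center_notMem_inner
  have hcL := hs.center_notMem_outer
  have hNL := Finset.disjoint_left.1 hs.disjoint
  refine ⟨x, p z, z, ?_, (hs.adj_inner x (by grind)).symm, hs.adj_inner _ hy,
    (hs.adj_outer z (by simp)).symm, ?_⟩
  · grind
  · simp only [List.nodup_cons, List.mem_cons]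
    grind

end IsSpider

lemma injective_vec_of_nodup {V : Type*} {x c y z : V} (h : [x, c, y, z].Nodup) :
    Function.Injective ![x, c, y, z] := by
  intro a b hab
  apply List.nodup_iff_injective_get.1 h
  fin_cases a <;> fin_cases b <;> exact hab

namespace IsPathPartition

variable {V : Type*} [DecidableEq V] {G : SimpleGraph V} {C S : Finset V} {f : V → Fin 4 → V}

lemma eq_image (hf : IsPathPartition G C f S) :
    S = (C ×ˢ (univ : Finset (Fin 4))).image fun x => f x.1 x.2 := by
  ext v
  simp [hf.mem_iff]

lemma sum_eq (hf : IsPathPartition G C f S) (h : V → ℕ) :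
    ∑ v ∈ S, h v = ∑ i ∈ C, ∑ a, h (f i a) := by
  rw [hf.eq_image, Finset.sum_image, Finset.sum_product]
  rintro ⟨i, a⟩ hi ⟨j, b⟩ hj hij
  simp only [coe_product, Set.mem_prod, Finset.mem_coe] at hi hj
  simpa using hf.inj i hi.1 j hj.1 a b hij

lemma card_eq (hf : IsPathPartition G C f S) : #S = 4 * #C := by
  simpa [mul_comm] using hf.sum_eq 1

lemma hasLabelling (hf : IsPathPartition G C f S) (l : V → Fin 4 → ℕ)
    (hl : ∀ i ∈ C, ∀ a, l i a = 3 ∨ l i a = 4 ∨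
      (l i a = 0 ∧ ∃ j ∈ C, ∃ b, G.Adj (f i a) (f j b) ∧ l j b = 4)) :
    HasLabelling G S (∑ i ∈ C, ∑ a, l i a) := by
  classical
  obtain ⟨h, hout, hh⟩ : ∃ h : V → ℕ, (∀ v ∉ S, h v = 0) ∧ ∀ i ∈ C, ∀ a, h (f i a) = l i a := by
    refine ⟨fun v => if hv : ∃ x : V × Fin 4, x.1 ∈ C ∧ f x.1 x.2 = v then
      l hv.choose.1 hv.choose.2 else 0, fun v hv => ?_, fun i hi a => ?_⟩
    · refine dif_neg ?_
      rintro ⟨⟨i, a⟩, hi, rfl⟩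
      exact hv ((hf.mem_iff _).2 ⟨i, hi, a, rfl⟩)
    · have hv : ∃ x : V × Fin 4, x.1 ∈ C ∧ f x.1 x.2 = f i a := ⟨(i, a), hi, rfl⟩
      obtain ⟨h1, h2⟩ := hf.inj _ hv.choose_spec.1 i hi _ _ hv.choose_spec.2
      simp only [dif_pos hv, h1, h2]
  refine ⟨h, hout, fun v hv => ?_, ?_⟩
  · obtain ⟨i, hi, a, rfl⟩ := (hf.mem_iff v).1 hv
    rcases hl i hi a with h3 | h4 | ⟨h0, j, hj, b, hadj, h4⟩
    · exact .inr (.inr (.inl (by rw [hh i hi, h3])))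
    · exact .inr (.inr (.inr (by rw [hh i hi, h4])))
    · exact .inl ⟨by rw [hh i hi, h0], .inl ⟨_, hadj, by rw [hh j hj, h4]⟩⟩
  · rw [hf.sum_eq]
    exact Finset.sum_congr rfl fun i hi => Finset.sum_congr rfl fun a _ => hh i hi a

/-- Labelling every path by `0, 4, 0, 3` except for the path `i`, which is labelled more cheaply
by making use of second vertices of other paths. -/
lemma isCheap (hf : IsPathPartition G C f S) {i : V} (hi : i ∈ C) (m : Fin 4 → ℕ)
    (hsum : ∑ a, m a < 7)
    (hm : ∀ a, m a = 3 ∨ m a = 4 ∨ (m a = 0 ∧ ((∃ b, G.Adj (f i a) (f i b) ∧ m b = 4) ∨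
      ∃ j ∈ C, j ≠ i ∧ G.Adj (f i a) (f j 1)))) : IsCheap G S := by
  refine ⟨_, hf.hasLabelling (Function.update (fun _ => ![0, 4, 0, 3]) i m) ?_, ?_⟩
  · intro j hj a
    by_cases hji : j = i
    · subst hji
      rw [Function.update_self]
      rcases hm a with h3 | h4 | ⟨h0, ⟨b, hb, hb4⟩ | ⟨k, hk, hkj, hadj⟩⟩
      · exact .inl h3
      · exact .inr (.inl h4)
      · exact .inr (.inr ⟨h0, j, hj, b, hb, by simpa⟩)
      · exact .inr (.inr ⟨h0, k, hk, 1, hadj, by simp [hkj]⟩)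
    · rw [Function.update_of_ne hji]
      fin_cases a
      · exact .inr (.inr ⟨by simp, j, hj, 1, hf.adj01 j hj, by simp [hji]⟩)
      · simp
      · exact .inr (.inr ⟨by simp, j, hj, 1, (hf.adj12 j hj).symm, by simp [hji]⟩)
      · simp
  · rw [hf.card_eq, ← Finset.add_sum_erase C _ hi, Function.update_self,
      Finset.sum_congr rfl (g := fun _ => 7) (s₁ := C.erase i)
        (by intro j hj; rw [Function.update_of_ne (Finset.ne_of_mem_erase hj)]; rfl)]
    have := Finset.card_pos.2 ⟨i, hi⟩
    simp [Finset.card_erase_of_mem hi]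
    lia

lemma hasLabelling_seven (hf : IsPathPartition G C f S) : HasLabelling G S (7 * #C) := by
  convert hf.hasLabelling (fun _ => ![0, 4, 0, 3]) ?_
  · simp [Fin.sum_univ_four, mul_comm]
  · intro j hj a
    fin_cases a
    · exact .inr (.inr ⟨rfl, j, hj, 1, hf.adj01 j hj, rfl⟩)
    · simp
    · exact .inr (.inr ⟨rfl, j, hj, 1, (hf.adj12 j hj).symm, rfl⟩)
    · simp

lemma insert_path (hf : IsPathPartition G C f S) {x c y z : V} (hcC : c ∉ C)
    (hdisj : Disjoint S {x, c, y, z}) (hnodup : [x, c, y, z].Nodup) (hxc : G.Adj x c)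
    (hcy : G.Adj c y) (hyz : G.Adj y z) :
    IsPathPartition G (insert c C) (Function.update f c ![x, c, y, z]) (S ∪ {x, c, y, z}) := by
  have hup : ∀ i ∈ C, Function.update f c ![x, c, y, z] i = f i :=
    fun i hi => Function.update_of_ne (ne_of_mem_of_not_mem hi hcC) _ _
  have hinj := injective_vec_of_nodup hnodup
  have hrange : ∀ v, v ∈ ({x, c, y, z} : Finset V) ↔ ∃ a, ![x, c, y, z] a = v := by
    simp [Fin.exists_fin_succ, eq_comm]
  have hS : ∀ i ∈ C, ∀ a b, f i a ≠ ![x, c, y, z] b := fun i hi a b h =>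
    Finset.disjoint_left.1 hdisj ((hf.mem_iff _).2 ⟨i, hi, a, rfl⟩) ((hrange _).2 ⟨b, h.symm⟩)
  constructor
  · intro i hi j hj a b hab
    rcases Finset.mem_insert.1 hi with rfl | hi' <;>
      rcases Finset.mem_insert.1 hj with rfl | hj'
    · rw [Function.update_self] at hab
      exact ⟨rfl, hinj hab⟩
    · rw [Function.update_self, hup j hj'] at hab
      exact (hS j hj' _ _ hab.symm).elim
    · rw [Function.update_self, hup i hi'] at hab
      exact (hS i hi' _ _ hab).elim
    · rw [hup i hi', hup j hj'] at hab
      exact hf.inj i hi' j hj' a b hab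
  · intro v
    rw [Finset.mem_union, hf.mem_iff, hrange, Finset.exists_mem_insert, Function.update_self,
      or_comm]
    refine or_congr_right (exists_congr fun i => and_congr_right fun hi => ?_)
    rw [hup i hi]
  · exact (Finset.forall_mem_insert _ _ _).2 ⟨by rw [Function.update_self]; exact hxc,
      fun i hi => by rw [hup i hi]; exact hf.adj01 i hi⟩
  · exact (Finset.forall_mem_insert _ _ _).2 ⟨by rw [Function.update_self]; exact hcy,
      fun i hi => by rw [hup i hi]; exact hf.adj12 i hi⟩
  · exact (Finset.forall_mem_insert _ _ _).2 ⟨by rw [Function.update_self]; exact hyz,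
      fun i hi => by rw [hup i hi]; exact hf.adj23 i hi⟩

end IsPathPartition

namespace IsCenteredPartition

variable {V : Type*} {G : SimpleGraph V} {C S : Finset V} {f : V → Fin 4 → V}

lemma empty : IsCenteredPartition G ∅ (fun v _ => v) ∅ := by
  constructor
  · constructor <;> simp
  all_goals simp

lemma subset (hf : IsCenteredPartition G C f S) : C ⊆ S :=
  fun i hi => (hf.mem_iff i).2 ⟨i, hi, 1, hf.center i hi⟩

/-- A single path may be reversed. -/
lemma reverse {i : V} (hf : IsCenteredPartition G {i} f S) :
    IsCenteredPartition G {f i 2} (fun _ a => f i a.rev) S where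
  inj := by
    simp only [Finset.mem_singleton]
    rintro j rfl k rfl a b hab
    exact ⟨rfl, Fin.rev_injective (hf.inj i (by simp) i (by simp) _ _ hab).2⟩
  mem_iff v := by
    simp only [hf.mem_iff, Finset.mem_singleton, exists_eq_left]
    exact Fin.rev_surjective.exists
  adj01 _ _ := (hf.adj23 i (by simp)).symm
  adj12 _ _ := (hf.adj12 i (by simp)).symm
  adj23 _ _ := (hf.adj01 i (by simp)).symm
  center j hj := (Finset.mem_singleton.1 hj).symm
  cross j hj k hk hjk := by simp_all

variable [DecidableEq V]

lemma insert_path (hf : IsCenteredPartition G C f S) {x c y z : V}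
    (hdisj : Disjoint S {x, c, y, z}) (hnodup : [x, c, y, z].Nodup) (hxc : G.Adj x c)
    (hcy : G.Adj c y) (hyz : G.Adj y z)
    (hcross : ∀ q ∈ ({x, c, y, z} : Finset V), ∀ s ∈ S, G.Adj q s → q = c ∧ s ∈ C) :
    IsCenteredPartition G (insert c C) (Function.update f c ![x, c, y, z])
      (S ∪ {x, c, y, z}) := by
  have hcC : c ∉ C := fun h => Finset.disjoint_left.1 hdisj (hf.subset h) (by simp)
  have hup : ∀ i ∈ C, Function.update f c ![x, c, y, z] i = f i :=
    fun i hi => Function.update_of_ne (ne_of_mem_of_not_mem hi hcC) _ _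
  have hmem : ∀ a, ![x, c, y, z] a ∈ ({x, c, y, z} : Finset V) := by
    simp [Fin.forall_fin_succ]
  have hadj : ∀ j ∈ C, ∀ a b, G.Adj (![x, c, y, z] a) (f j b) → a = 1 ∧ b = 1 := by
    intro j hj a b h
    obtain ⟨h1, h2⟩ := hcross _ (hmem a) _ ((hf.mem_iff _).2 ⟨j, hj, b, rfl⟩) h
    exact ⟨injective_vec_of_nodup hnodup h1, (hf.inj _ h2 j hj 1 b (hf.center _ h2)).2.symm⟩
  refine ⟨hf.toIsPathPartition.insert_path hcC hdisj hnodup hxc hcy hyz, ?_, ?_⟩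
  · intro i hi
    rcases Finset.mem_insert.1 hi with rfl | hi
    · simp
    · rw [hup i hi, hf.center i hi]
  · intro i hi j hj hij a b h
    rcases Finset.mem_insert.1 hi with rfl | hi' <;>
      rcases Finset.mem_insert.1 hj with rfl | hj'
    · exact (hij rfl).elim
    · rw [Function.update_self, hup j hj'] at h
      exact (hadj j hj' a b h).1
    · rw [Function.update_self, hup i hi'] at h
      exact (hadj i hi' b a h.symm).2
    · rw [hup i hi', hup j hj'] at h
      exact hf.cross i hi' j hj' hij a b h

end IsCenteredPartition

lemma SimpleGraph.IsTree.isRooted {V : Type*} {G : SimpleGraph V} (hG : G.IsTree) (r : V) :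
    ∃ par d, IsRooted G r par d := by
  classical
  choose w hw huniq using fun v => hG.existsUnique_path v r
  have hwr : w r = Walk.nil := (huniq r _ Walk.IsPath.nil).symm
  have hnil : ∀ v, v ≠ r → ¬ (w v).Nil := fun v hv => Walk.not_nil_of_ne hv
  have htail : ∀ v, w (w v).snd = (w v).tail := fun v => (huniq _ _ (hw v).tail).symm
  have hadj : ∀ u v, G.Adj u v → u ∉ (w v).support → (w u).snd = v := by
    intro u v h hu
    rw [← huniq u (Walk.cons h (w v)) ((hw v).cons hu)]
    simp
  refine ⟨fun v => (w v).snd, fun v => (w v).length, by simp [hwr], by simp [hwr],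
    fun v hv => (w v).adj_snd (hnil v hv), fun v hv => ?_, fun u v h => ?_⟩
  · simp only [htail, Walk.length_tail_add_one (hnil v hv)]
  · by_cases hu : u ∈ (w v).support
    · exact .inr (hG.isAcyclic.eq_snd_of_adj_start (hw v) h.symm hu).symm
    · exact .inl (hadj u v h hu)

namespace IsRooted

variable {V : Type*} {G : SimpleGraph V} {r : V} {par : V → V} {d : V → ℕ}

lemma par_ne (hr : IsRooted G r par d) {v : V} (hv : v ≠ r) : par v ≠ v :=
  fun h => (hr.adj_par v hv).ne h.symm

lemma root_mem (hr : IsRooted G r par d) {S : Finset V} (hS : ∀ v ∈ S, par v ∈ S)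
    (hne : S.Nonempty) : r ∈ S := by
  obtain ⟨v, hv, hmin⟩ := S.exists_min_image d hne
  by_contra hrS
  have hvr : v ≠ r := ne_of_mem_of_not_mem hv hrS
  have := hmin _ (hS v hv)
  have := hr.depth_par v hvr
  lia

/-- A set closed under taking parents is connected. -/
lemma eq_of_forall_adj (hr : IsRooted G r par d) {S Q : Finset V} (hS : ∀ v ∈ S, par v ∈ S)
    (hQS : Q ⊆ S) (hne : Q.Nonempty) (hQ : ∀ q ∈ Q, ∀ s ∈ S, G.Adj q s → s ∈ Q) : Q = S := by
  have hrQ : r ∈ Q := by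
    refine hr.root_mem (fun v hv => ?_) hne
    by_cases hvr : v = r
    · rwa [hvr, hr.par_root, ← hvr]
    · exact hQ v hv _ (hS v (hQS hv)) (hr.adj_par v hvr)
  refine hQS.antisymm fun s hs => ?_
  induction hn : d s generalizing s with
  | zero =>
    by_cases hsr : s = r
    · rwa [hsr]
    · have := hr.depth_par s hsr
      lia
  | succ n ih =>
    have hsr : s ≠ r := by
      rintro rfl
      have := hr.depth_root
      lia
    have := hr.depth_par s hsr
    exact hQ _ (ih (par s) (hS s hs) (by lia)) s hs (hr.adj_par s hsr).symm

/-- Along an edge, the parent relation and the depth agree. -/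
lemma par_eq_and_depth_eq_or (hr : IsRooted G r par d) {u v : V} (huv : G.Adj u v) :
    (par u = v ∧ d u = d v + 1) ∨ (par v = u ∧ d v = d u + 1) := by
  rcases hr.par_eq_or u v huv with h | h
  · have hur : u ≠ r := by
      rintro rfl
      exact huv.ne (hr.par_root.symm.trans h)
    exact .inl ⟨h, h ▸ hr.depth_par u hur⟩
  · have hvr : v ≠ r := by
      rintro rfl
      exact huv.ne (h.symm.trans hr.par_root)
    exact .inr ⟨h, h ▸ hr.depth_par v hvr⟩

lemma not_adj_of_adj_of_adj (hr : IsRooted G r par d) {x y z : V} (hxy : G.Adj x y)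
    (hyz : G.Adj y z) : ¬ G.Adj x z := by
  intro hxz
  have := hr.par_eq_and_depth_eq_or hxy
  have := hr.par_eq_and_depth_eq_or hyz
  have := hr.par_eq_and_depth_eq_or hxz
  lia

lemma not_adj_of_path (hr : IsRooted G r par d) {x y z w : V} (hxy : G.Adj x y)
    (hyz : G.Adj y z) (hzw : G.Adj z w) (hxz : x ≠ z) (hyw : y ≠ w) : ¬ G.Adj x w := by
  intro hxw
  have := hr.par_eq_and_depth_eq_or hxy
  have := hr.par_eq_and_depth_eq_or hyz
  have := hr.par_eq_and_depth_eq_or hzw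
  have := hr.par_eq_and_depth_eq_or hxw
  grind

variable [DecidableEq V]

/-- A set closed under taking parents contains a full subtree which is a spider. -/
lemma exists_isSpider (hr : IsRooted G r par d) {S : Finset V} (hS : ∀ v ∈ S, par v ∈ S)
    (hcard : 3 ≤ #S) : ∃ c N L, IsSpider G c N L par ∧ insert c (N ∪ L) ⊆ S ∧
      (∀ n ∈ N, par n = c) ∧ (∀ v ∈ N ∪ L, v ≠ r) ∧
      ∀ v ∈ S, v ≠ r → par v ∈ insert c (N ∪ L) → v ∈ insert c (N ∪ L) := by
  have hadj : ∀ v, v ≠ r → G.Adj (par v) v := fun v hv => (hr.adj_par v hv).symm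
  have hd := hr.depth_par
  by_cases hA : ∃ c ∈ S, 2 ≤ #{z ∈ S | z ≠ r ∧ par z = c} ∧
      ∀ z ∈ S, z ≠ r → par z = c → ∀ t ∈ S, t ≠ r → par t ≠ z
  · obtain ⟨c, hc, h2, hleaf⟩ := hA
    refine ⟨c, {z ∈ S | z ≠ r ∧ par z = c}, ∅, ?_, ?_, ?_, ?_, ?_⟩
    · constructor
      case center_notMem_inner =>
        have := hr.par_ne (v := c)
        grind
      case one_le => lia
      all_goals first | (simp; done) | (simp; lia) | grind
    all_goals grind
  · have hB : ∀ c ∈ S, (∀ z ∈ S, z ≠ r → par z = c → ∀ t ∈ S, t ≠ r → par t ≠ z) →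
        ∀ y ∈ S, y ≠ r → ∀ z ∈ S, z ≠ r → par y = c → par z = c → y = z := by
      intro c hc hleaf y hy hyr z hz hzr hyc hzc
      by_contra hyz
      refine hA ⟨c, hc, Finset.one_lt_card.2 ⟨y, ?_, z, ?_, hyz⟩, hleaf⟩ <;> simp [*]
    obtain ⟨x, hx, hmax⟩ := S.exists_max_image d (Finset.card_pos.1 (by lia))
    have hB' : ∀ y ∈ S, y ≠ r → ∀ z ∈ S, z ≠ r → par y = par z → d y = d x → y = z := by
      intro y hy hyr z hz hzr hyz hyx
      refine hB (par z) (hS z hz) ?_ y hy hyr z hz hzr hyz rfl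
      intro s hs hsr hsz t ht htr hts
      have := hmax t ht
      have := hd t htr
      have := hd s hsr
      have := hd y hyr
      grind
    have hr0 := hr.depth_root
    have hxr : x ≠ r := by
      rintro rfl
      have : S ⊆ {x} := by grind
      have := Finset.card_le_card this
      simp at this
      lia
    have hpxr : par x ≠ r := by
      intro hpx
      have : S ⊆ {r, x} := by grind
      have := Finset.card_le_card this
      have := Finset.card_le_two (a := r) (b := x)
      lia
    have hpx := hS x hx
    obtain ⟨c, hc⟩ : ∃ c, c = par (par x) := ⟨_, rfl⟩
    obtain ⟨N, hN⟩ : ∃ N : Finset V, ∀ n, n ∈ N ↔ n ∈ S ∧ n ≠ r ∧ par n = c :=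
      ⟨{z ∈ S | z ≠ r ∧ par z = c}, by simp⟩
    obtain ⟨L, hL⟩ : ∃ L : Finset V, ∀ l, l ∈ L ↔ l ∈ S ∧ l ≠ r ∧ par l ∈ N :=
      ⟨{z ∈ S | z ≠ r ∧ par z ∈ N}, by simp⟩
    have hpN : par x ∈ N := (hN _).2 ⟨hpx, hpxr, hc.symm⟩
    have hxL : x ∈ L := (hL _).2 ⟨hx, hxr, hpN⟩
    have hdx : d x = d c + 2 := by rw [hd x hxr, hd _ hpxr, hc]
    have hdN : ∀ n ∈ N, d n = d c + 1 := fun n hn => by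
      rw [hd n ((hN n).1 hn).2.1, ((hN n).1 hn).2.2]
    have hdL : ∀ l ∈ L, d l = d c + 2 := fun l hl => by
      rw [hd l ((hL l).1 hl).2.1, hdN _ ((hL l).1 hl).2.2]
    refine ⟨c, N, L, ?_, ?_, fun n hn => ((hN n).1 hn).2.2, ?_, ?_⟩
    · constructor
      · exact fun h => by simpa using hdN c h
      · exact fun h => by simpa using hdL c h
      · refine Finset.disjoint_left.2 fun v hv hv' => ?_
        have := hdN v hv
        have := hdL v hv'
        lia
      · exact fun n hn => ((hN n).1 hn).2.2 ▸ hadj n ((hN n).1 hn).2.1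
      · exact fun l hl => ((hL l).1 hl).2.2
      · exact fun l hl => hr.adj_par l ((hL l).1 hl).2.1
      · intro y hy z hz hyz
        obtain ⟨hyS, hyr, -⟩ := (hL y).1 hy
        obtain ⟨hzS, hzr, -⟩ := (hL z).1 hz
        exact hB' y hyS hyr z hzS hzr hyz ((hdL y hy).trans hdx.symm)
      · exact Finset.card_pos.2 ⟨_, hpN⟩
      · have := Finset.card_pos.2 ⟨_, hpN⟩
        have := Finset.card_pos.2 ⟨_, hxL⟩
        lia
    · have := hS _ hpx
      grind
    · grind
    · intro v hv hvr hpv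
      have := hmax v hv
      have := hd v hvr
      simp only [Finset.mem_insert, Finset.mem_union] at hpv ⊢
      rcases hpv with h | h | h
      · exact .inr (.inl ((hN v).2 ⟨hv, hvr, h⟩))
      · exact .inr (.inr ((hL v).2 ⟨hv, hvr, h⟩))
      · have := hdL _ h
        lia

/-- A set closed under taking parents is a spider, or removing a spider attached by its centre
leaves at least three vertices. -/
lemma exists_isSpider_card (hr : IsRooted G r par d) {S : Finset V} (hS : ∀ v ∈ S, par v ∈ S)
    (hcard : 3 ≤ #S) : ∃ c N L p, IsSpider G c N L p ∧ insert c (N ∪ L) ⊆ S ∧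
      (insert c (N ∪ L) = S ∨ (3 ≤ #(S \ insert c (N ∪ L)) ∧
        (∀ v ∈ S \ insert c (N ∪ L), par v ∈ S \ insert c (N ∪ L)) ∧
        ∀ q ∈ insert c (N ∪ L), ∀ s ∈ S \ insert c (N ∪ L), G.Adj q s → q = c ∧ s = par c)) := by
  obtain ⟨c, N, L, hs, hsub, hN, hNL, hup⟩ := hr.exists_isSpider hS hcard
  have hcN := hs.center_notMem_inner
  have hcL := hs.center_notMem_outer
  have hdisj := Finset.disjoint_left.1 hs.disjoint
  have hL := hs.map_outer
  have hroot := hr.par_root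
  set P := insert c (N ∪ L) with hP
  have hclosed : ∀ v ∈ S \ P, par v ∈ S \ P := by grind
  by_cases hPS : P = S
  · exact ⟨c, N, L, par, hs, hsub, .inl hPS⟩
  have hne : (S \ P).Nonempty := Finset.sdiff_nonempty.2 fun h => hPS (hsub.antisymm h)
  have hrR := hr.root_mem hclosed hne
  have hcr : c ≠ r := by grind
  have hpc : par c ∈ S \ P := by
    have := hr.depth_par
    have := hS c (by grind)
    grind
  by_cases h3 : 3 ≤ #(S \ P)
  · refine ⟨c, N, L, par, hs, hsub, .inr ⟨h3, hclosed, fun q hq s hs' hqs => ?_⟩⟩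
    have := hr.par_eq_or q s hqs
    grind
  have hpos := hne.card_pos
  have hadj := (hr.adj_par c hcr)
  obtain h1 | h2 : #(S \ P) = 1 ∨ #(S \ P) = 2 := by lia
  · obtain ⟨u, hu⟩ := Finset.card_eq_one.1 h1
    have hpu : par c = u := by grind
    have hSeq : insert c (insert u N ∪ L) = S := by grind
    refine ⟨c, insert u N, L, par, ?_, hSeq.subset, .inl hSeq⟩
    have huP : u ∉ P := by grind
    have := hs.adj_inner
    have := hs.adj_outer
    have := hs.two_le
    have hcard : #(insert u N) = #N + 1 := Finset.card_insert_of_notMem (by grind)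
    constructor
    · grind
    · grind
    · rw [Finset.disjoint_left]
      grind
    · grind
    · grind
    · grind
    · exact hs.injOn
    · lia
    · lia
  · obtain ⟨w, hw⟩ := Finset.card_eq_one.1
      (show #((S \ P).erase (par c)) = 1 by rw [Finset.card_erase_of_mem hpc, h2])
    set u := par c with hu
    have hwR : w ∈ (S \ P).erase u := by simp [hw]
    have hR : S \ P = {u, w} := by rw [← Finset.insert_erase hpc, hw]
    have huw : G.Adj w u := by
      have := hr.adj_par u
      have := hr.adj_par w
      have := hr.par_ne (v := u)
      have := hr.par_ne (v := w)
      have := hclosed u (by grind)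
      have := hclosed w (by grind)
      rcases eq_or_ne w r with rfl | hwr
      · have : par u = w := by grind
        grind [G.adj_comm]
      · have : par w = u := by grind
        grind
    have hSeq : insert c (insert u N ∪ insert w L) = S := by grind
    refine ⟨c, insert u N, insert w L, Function.update par w u, ?_, hSeq.subset, .inl hSeq⟩
    have huP : u ∉ P := by grind
    have hwP : w ∉ P := by grind
    have := hs.adj_inner
    have := hs.adj_outer
    have := hs.two_le
    have := hs.one_le
    have hcard : #(insert u N) = #N + 1 := Finset.card_insert_of_notMem (by grind)
    have hcard' : #(insert w L) = #L + 1 := Finset.card_insert_of_notMem (by grind)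
    have hpar : ∀ l ∈ L, Function.update par w u l = par l := by grind [Function.update_of_ne]
    constructor
    · grind
    · grind
    · rw [Finset.disjoint_left]
      grind
    · grind
    · grind
    · grind
    · rw [Finset.coe_insert, Set.injOn_insert (by grind)]
      refine ⟨hs.injOn.congr fun l hl => (hpar l hl).symm, ?_⟩
      rintro ⟨l, hl, h⟩
      rw [hpar l hl, Function.update_self] at h
      exact huP (h ▸ by grind)
    · lia
    · lia

end IsRooted

section CheapOrPartition

variable {V : Type*} [DecidableEq V] {G : SimpleGraph V} {r : V} {par : V → V} {d : V → ℕ}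

/-- Attach a path by its second vertex `c` to a set which is partitioned into paths. -/
lemma IsCenteredPartition.isCheap_or_exists {C S : Finset V} {f : V → Fin 4 → V}
    (hf : IsCenteredPartition G C f S) (hr : IsRooted G r par d) (hS : ∀ v ∈ S, par v ∈ S)
    {x c y z u : V} (hdisj : Disjoint S {x, c, y, z}) (hnodup : [x, c, y, z].Nodup)
    (hxc : G.Adj x c) (hcy : G.Adj c y) (hyz : G.Adj y z)
    (hcross : ∀ q ∈ ({x, c, y, z} : Finset V), ∀ s ∈ S, G.Adj q s → q = c ∧ s = u) :
    IsCheap G (S ∪ {x, c, y, z}) ∨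
      ∃ C' f', IsCenteredPartition G C' f' (S ∪ {x, c, y, z}) := by
  have hcC : c ∉ C := fun h => Finset.disjoint_left.1 hdisj (hf.subset h) (by simp)
  by_cases hcenter : ∀ s ∈ S, G.Adj c s → s ∈ C
  · refine .inr ⟨_, _, hf.insert_path hdisj hnodup hxc hcy hyz fun q hq s hs h => ?_⟩
    obtain ⟨rfl, -⟩ := hcross q hq s hs h
    exact ⟨rfl, hcenter s hs h⟩
  push Not at hcenter
  obtain ⟨s, hs, hcs, hsC⟩ := hcenter
  obtain ⟨i, hi, a, rfl⟩ := (hf.mem_iff s).1 hs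
  obtain ⟨-, rfl⟩ := hcross c (by simp) _ hs hcs
  have hic : i ≠ c := ne_of_mem_of_not_mem hi hcC
  have hpart := hf.toIsPathPartition.insert_path hcC hdisj hnodup hxc hcy hyz
  have hi' : i ∈ insert c C := Finset.mem_insert_of_mem hi
  set g := Function.update f c ![x, c, y, z] with hg
  have hgc : g c 1 = c := by simp [hg]
  have hgi : ∀ j ∈ C, g j = f j := fun j hj =>
    Function.update_of_ne (ne_of_mem_of_not_mem hj hcC) _ _
  have hga : ∃ j ∈ insert c C, j ≠ i ∧ G.Adj (g i a) (g j 1) :=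
    ⟨c, by simp, hic.symm, by rw [hgc, hgi i hi]; exact hcs.symm⟩
  have h01 := hpart.adj01 i hi'
  have h12 := hpart.adj12 i hi'
  have h23 := hpart.adj23 i hi'
  obtain rfl | rfl | rfl | rfl : a = 0 ∨ a = 1 ∨ a = 2 ∨ a = 3 := by lia
  · refine .inl (hpart.isCheap hi' ![0, 0, 4, 0] (by decide) fun a => ?_)
    fin_cases a
    · exact .inr (.inr ⟨rfl, .inr hga⟩)
    · exact .inr (.inr ⟨rfl, .inl ⟨2, h12, rfl⟩⟩)
    · exact .inr (.inl rfl)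
    · exact .inr (.inr ⟨rfl, .inl ⟨2, h23.symm, rfl⟩⟩)
  · exact (hsC (by rwa [hf.center i hi])).elim
  · by_cases hother : ∃ j ∈ C, j ≠ i ∧ G.Adj (f i 1) (f j 1)
    · obtain ⟨j, hj, hji, hadj⟩ := hother
      refine .inl (hpart.isCheap hi' ![3, 0, 0, 3] (by decide) fun a => ?_)
      fin_cases a
      · exact .inl rfl
      · exact .inr (.inr ⟨rfl, .inr ⟨j, Finset.mem_insert_of_mem hj, hji, by
          rw [hgi i hi, hgi j hj]; exact hadj⟩⟩)
      · exact .inr (.inr ⟨rfl, .inr hga⟩)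
      · exact .inl rfl
    · have himage : univ.image (f i) = S := by
        refine hr.eq_of_forall_adj hS (fun v hv => ?_) (by simp) fun q hq s hs' hqs => ?_
        · obtain ⟨b, -, rfl⟩ := Finset.mem_image.1 hv
          exact (hf.mem_iff _).2 ⟨i, hi, b, rfl⟩
        · obtain ⟨b, -, rfl⟩ := Finset.mem_image.1 hq
          obtain ⟨j, hj, b', rfl⟩ := (hf.mem_iff _).1 hs'
          by_cases hji : j = i
          · simp [hji]
          · obtain rfl := hf.cross i hi j hj (Ne.symm hji) b b' hqs
            obtain rfl := hf.cross j hj i hi hji b' _ hqs.symm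
            exact (hother ⟨j, hj, hji, hqs⟩).elim
      obtain rfl : C = {i} := by
        refine Finset.eq_singleton_iff_unique_mem.2 ⟨hi, fun j hj => ?_⟩
        have := hf.subset hj
        rw [← himage] at this
        obtain ⟨b, -, hb⟩ := Finset.mem_image.1 this
        exact (hf.inj i hi j hj b 1 (hb.trans (hf.center j hj).symm)).1.symm
      refine .inr ⟨_, _, hf.reverse.insert_path hdisj hnodup hxc hcy hyz fun q hq s hs' h => ?_⟩
      obtain ⟨h1, h2⟩ := hcross q hq s hs' h
      exact ⟨h1, by simp [h2]⟩
  · refine .inl (hpart.isCheap hi' ![0, 4, 0, 0] (by decide) fun a => ?_)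
    fin_cases a
    · exact .inr (.inr ⟨rfl, .inl ⟨1, h01, rfl⟩⟩)
    · exact .inr (.inl rfl)
    · exact .inr (.inr ⟨rfl, .inl ⟨1, h12.symm, rfl⟩⟩)
    · exact .inr (.inr ⟨rfl, .inr hga⟩)

/-- A set of at least three vertices which is closed under taking parents is cheap to dominate or
partitioned into paths whose second vertices form a tree. -/
lemma IsRooted.isCheap_or_exists (hr : IsRooted G r par d) (S : Finset V)
    (hS : ∀ v ∈ S, par v ∈ S) (hcard : 3 ≤ #S) :
    IsCheap G S ∨ ∃ C f, IsCenteredPartition G C f S := by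
  induction S using Finset.strongInduction with
  | H S ih =>
    obtain ⟨c, N, L, p, hs, hsub, heq | ⟨h3, hclosed, hcross⟩⟩ := hr.exists_isSpider_card hS hcard
    · rw [← heq]
      rcases hs.isCheap_or with h | ⟨-, hN, hL⟩
      · exact .inl h
      · obtain ⟨x, y, z, hP, hxc, hcy, hyz, hnodup⟩ := hs.exists_path hN hL
        have := (IsCenteredPartition.empty (G := G)).insert_path
          (Finset.disjoint_empty_left _) hnodup hxc hcy hyz (by simp)
        rw [Finset.empty_union, ← hP] at this
        exact .inr ⟨_, _, this⟩
    · have hunion := Finset.sdiff_union_of_subset hsub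
      have hdisj : Disjoint (S \ insert c (N ∪ L)) (insert c (N ∪ L)) := Finset.sdiff_disjoint
      have hsum := Finset.card_union_of_disjoint hdisj
      have hssub : S \ insert c (N ∪ L) ⊂ S := Finset.sdiff_ssubset hsub (by simp)
      generalize S \ insert c (N ∪ L) = R at *
      rw [← hunion]
      rcases ih R hssub hclosed h3 with ⟨n, hn, hlt⟩ | ⟨C, f, hf⟩
      · obtain ⟨m, hm, hle⟩ : ∃ m, HasLabelling G (insert c (N ∪ L)) m ∧
            4 * m ≤ 7 * #(insert c (N ∪ L)) := by
          rcases hs.isCheap_or with ⟨m, hm, h⟩ | ⟨h7, hN, hL⟩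
          · exact ⟨m, hm, h.le⟩
          · exact ⟨7, h7, by rw [hs.card_eq]; lia⟩
        exact .inl ⟨_, hn.union hm hdisj, by lia⟩
      · rcases hs.isCheap_or with ⟨m, hm, hlt⟩ | ⟨-, hN, hL⟩
        · have := hf.card_eq
          exact .inl ⟨_, hf.hasLabelling_seven.union hm hdisj, by lia⟩
        · obtain ⟨x, y, z, hP, hxc, hcy, hyz, hnodup⟩ := hs.exists_path hN hL
          rw [hP] at hdisj hcross ⊢
          exact hf.isCheap_or_exists hr hclosed hdisj hnodup hxc hcy hyz hcross

end CheapOrPartition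

lemma IsCenteredPartition.inFamilyF {V : Type*} [Fintype V] [Nonempty V] {G : SimpleGraph V}
    {C : Finset V} {f : V → Fin 4 → V} (hf : IsCenteredPartition G C f univ) (hG : G.IsTree) :
    InFamilyF G := by
  classical
  obtain ⟨r⟩ := ‹Nonempty V›
  obtain ⟨par, d, hr⟩ := hG.isRooted r
  let g : C × Fin 4 → V := fun x => f x.1 x.2
  have hg : Function.Bijective g := by
    constructor
    · rintro ⟨i, a⟩ ⟨j, b⟩ hij
      obtain ⟨h1, h2⟩ := hf.inj i i.2 j j.2 a b hij
      exact Prod.ext (Subtype.ext h1) h2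
    · intro v
      obtain ⟨i, hi, a, h⟩ := (hf.mem_iff v).1 (mem_univ v)
      exact ⟨(⟨i, hi⟩, a), h⟩
  let σ : C ≃ Fin #C := C.equivFin
  let e : V ≃ Fin #C × Fin 4 := (Equiv.ofBijective g hg).symm.trans (σ.prodCongr (Equiv.refl _))
  have he : ∀ k a, e.symm (k, a) = f (σ.symm k) a := fun k a => rfl
  refine ⟨#C, ?_, e, hG, ?_, ?_⟩
  · obtain ⟨i, hi, -⟩ := (hf.mem_iff r).1 (mem_univ r)
    exact Finset.card_pos.2 ⟨i, hi⟩
  · intro k a b hab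
    rw [he, he]
    have hk := (σ.symm k).2
    obtain ⟨rfl, rfl⟩ | ⟨rfl, rfl⟩ | ⟨rfl, rfl⟩ :
      (a = 0 ∧ b = 1) ∨ (a = 1 ∧ b = 2) ∨ (a = 2 ∧ b = 3) := by lia
    · exact hf.adj01 _ hk
    · exact hf.adj12 _ hk
    · exact hf.adj23 _ hk
  · intro u v huv
    obtain ⟨⟨k, a⟩, rfl⟩ := e.symm.surjective u
    obtain ⟨⟨k', b⟩, rfl⟩ := e.symm.surjective v
    simp only [Equiv.apply_symm_apply]
    rw [he, he] at huv
    by_cases hkk : k = k'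
    · subst hkk
      refine .inl ⟨rfl, ?_⟩
      have hk := (σ.symm k).2
      generalize (σ.symm k : V) = i at *
      have h01 := hf.adj01 i hk
      have h12 := hf.adj12 i hk
      have h23 := hf.adj23 i hk
      have h02 := hr.not_adj_of_adj_of_adj h01 h12
      have h13 := hr.not_adj_of_adj_of_adj h12 h23
      have h03 := hr.not_adj_of_path h01 h12 h23
        (fun h => by simpa using (hf.inj i hk i hk _ _ h).2)
        (fun h => by simpa using (hf.inj i hk i hk _ _ h).2)
      have hsymm := huv.symm
      fin_cases a <;> fin_cases b <;> simp_all
    · have hne : (σ.symm k : V) ≠ σ.symm k' := fun h =>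
        hkk (σ.symm.injective (Subtype.ext h))
      have ha := hf.cross _ (σ.symm k).2 _ (σ.symm k').2 hne a b huv
      have hb := hf.cross _ (σ.symm k').2 _ (σ.symm k).2 hne.symm b a huv.symm
      exact .inr ⟨hkk, by simp [ha], by simp [hb]⟩

lemma tripleRomanNumber_mem {V : Type*} [Fintype V] (G : SimpleGraph V) :
    ∃ h : V → ℕ, IsTRDF G h ∧ ∑ v, h v = tripleRomanNumber G :=
  Nat.sInf_mem (s := {w | ∃ h : V → ℕ, IsTRDF G h ∧ ∑ v, h v = w})
    ⟨_, fun _ => 3, ⟨by simp, by simp, by simp, by simp⟩, rfl⟩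

lemma IsTRDF.label_of_leaf {V : Type*} {G : SimpleGraph V} {h : V → ℕ} (hh : IsTRDF G h)
    {a b : V} (ha : ∀ v, G.Adj a v → v = b) :
    (h a = 0 → h b = 4) ∧ (h a = 1 → 3 ≤ h b) ∧ (h a = 2 → 2 ≤ h b) := by
  obtain ⟨-, h0, h1, h2⟩ := hh
  refine ⟨fun h => ?_, fun h => ?_, fun h => ?_⟩
  · rcases h0 a h with ⟨u, hu, h⟩ | ⟨u, w, hu, hw, h, h'⟩ | ⟨u, w, x, hu, hw, -, huw, -⟩
    · rwa [← ha u hu]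
    · rw [ha u hu] at h
      rw [ha w hw] at h'
      lia
    · exact (huw ((ha u hu).trans (ha w hw).symm)).elim
  · rcases h1 a h with ⟨u, hu, h⟩ | ⟨u, w, hu, hw, huw, -⟩
    · rwa [← ha u hu]
    · exact (huw ((ha u hu).trans (ha w hw).symm)).elim
  · obtain ⟨u, hu, h⟩ := h2 a h
    rwa [← ha u hu]

/-- A triple Roman dominating function has weight at least seven on a path whose first vertex is
a leaf, whose third vertex has no further neighbours, and whose last vertex is a leaf. -/
lemma IsTRDF.seven_le {V : Type*} {G : SimpleGraph V} {h : V → ℕ} (hh : IsTRDF G h)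
    {a b c d : V} (ha : ∀ v, G.Adj a v → v = b) (hc : ∀ v, G.Adj c v → v = b ∨ v = d)
    (hd : ∀ v, G.Adj d v → v = c) : 7 ≤ h a + h b + h c + h d := by
  obtain ⟨a0, a1, a2⟩ := hh.label_of_leaf ha
  obtain ⟨d0, d1, d2⟩ := hh.label_of_leaf hd
  have c0 : h c = 0 → h b = 4 ∨ h d = 4 ∨ (h b = 2 ∧ h d = 3) ∨ (h b = 3 ∧ h d = 2) := by
    intro h0
    rcases hh.2.1 c h0 with ⟨u, hu, h⟩ | ⟨u, w, hu, hw, h, h'⟩ |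
      ⟨u, w, x, hu, hw, hx, huw, hux, hwx, -⟩
    · rcases hc u hu with rfl | rfl <;> simp [h]
    · rcases hc u hu with rfl | rfl <;> rcases hc w hw with rfl | rfl <;> lia
    · rcases hc u hu with rfl | rfl <;> rcases hc w hw with rfl | rfl <;>
        rcases hc x hx with rfl | rfl <;> contradiction
  lia

lemma InFamilyF.four_mul_tripleRomanNumber {V : Type*} [Fintype V] {G : SimpleGraph V}
    (hG : InFamilyF G) : 4 * tripleRomanNumber G = 7 * Fintype.card V := by
  obtain ⟨k, -, e, -, hpath, hadj⟩ := hG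
  have hcard : Fintype.card V = k * 4 := by simpa using Fintype.card_congr e
  have hsum : ∀ h : V → ℕ, ∑ v, h v = ∑ i : Fin k, ∑ a : Fin 4, h (e.symm (i, a)) := by
    intro h
    rw [← e.symm.sum_comp, Fintype.sum_prod_type]
  have hle : tripleRomanNumber G ≤ 7 * k := by
    refine HasLabelling.tripleRomanNumber_le
      ⟨fun v => ![0, 4, 0, 3] (e v).2, by simp, fun v _ => ?_, ?_⟩
    · obtain ⟨⟨i, a⟩, rfl⟩ := e.symm.surjective v
      have h01 := hpath i 0 1 rfl
      have h12 := hpath i 1 2 rfl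
      fin_cases a
      · exact .inl ⟨by simp, .inl ⟨_, h01, by simp⟩⟩
      · simp [IsDominatedAt]
      · exact .inl ⟨by simp, .inl ⟨_, h12.symm, by simp⟩⟩
      · simp [IsDominatedAt]
    · simp [hsum, Fin.sum_univ_four, mul_comm]
  have hge : 7 * k ≤ tripleRomanNumber G := by
    obtain ⟨h, hh, hw⟩ := tripleRomanNumber_mem G
    rw [← hw, hsum]
    have hi : ∀ i : Fin k, 7 ≤ ∑ a : Fin 4, h (e.symm (i, a)) := by
      intro i
      have hnb : ∀ a v, G.Adj (e.symm (i, a)) v → a ≠ 1 →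
          ∃ b : Fin 4, v = e.symm (i, b) ∧ ((a : ℕ) + 1 = b ∨ (b : ℕ) + 1 = a) := by
        intro a v hav ha
        refine ⟨(e v).2, ?_⟩
        have := hadj _ _ hav
        simp only [Equiv.apply_symm_apply] at this
        rcases this with ⟨h1, h2⟩ | ⟨-, h2, -⟩
        · exact ⟨by simp [h1], h2⟩
        · exact (ha (Fin.ext h2)).elim
      rw [Fin.sum_univ_four]
      refine hh.seven_le (fun v hv => ?_) (fun v hv => ?_) (fun v hv => ?_)
      all_goals
        obtain ⟨b, rfl, hb⟩ := hnb _ v hv (by decide)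
        fin_cases b <;> simp_all
    calc 7 * k = ∑ _i : Fin k, 7 := by simp [mul_comm]
      _ ≤ _ := Finset.sum_le_sum fun i _ => hi i
  lia

/-- For a tree `T` of order `p ≥ 3`, `γ_[3R](T) = 7p/4` if and only if `T ∈ ℱ`. -/
theorem tripleRoman_tree_eq_iff {V : Type*} [Fintype V] (T : SimpleGraph V) (p : ℕ)
    (hp : Fintype.card V = p) (htree : T.IsTree) (hp3 : 3 ≤ p) :
    (tripleRomanNumber T : ℚ) = 7 * p / 4 ↔ InFamilyF T := by
  classical
  have hiff : (tripleRomanNumber T : ℚ) = 7 * p / 4 ↔ 4 * tripleRomanNumber T = 7 * p := by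
    rw [eq_div_iff (by norm_num), mul_comm]
    norm_cast
  rw [hiff]
  subst hp
  refine ⟨fun heq => ?_, InFamilyF.four_mul_tripleRomanNumber⟩
  have hne := htree.connected.nonempty
  obtain ⟨par, d, hr⟩ := htree.isRooted hne.some
  rcases hr.isCheap_or_exists univ (by simp) hp3 with ⟨n, hn, hlt⟩ | ⟨C, f, hf⟩
  · have := hn.tripleRomanNumber_le
    rw [Finset.card_univ] at hlt
    lia
  · exact hf.inFamilyF htree
end

section
/- If Γ is a nontrivial connected simple graph of order p ≥ 3, then γ_{[3R]}(Γ) ≤ 7p/4. -/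
open SimpleGraph Finset

/-- The triple Roman domination condition at a single vertex. -/
def LocalTRD {V : Type*} (G : SimpleGraph V) (h : V → ℕ) (v : V) : Prop :=
  h v ≤ 4 ∧
  (h v = 0 →
    (∃ u, G.Adj v u ∧ h u = 4) ∨
    (∃ u w, G.Adj v u ∧ G.Adj v w ∧ h u = 2 ∧ h w = 3) ∨
    (∃ u w x, G.Adj v u ∧ G.Adj v w ∧ G.Adj v x ∧ u ≠ w ∧ u ≠ x ∧ w ≠ x ∧
      h u = 2 ∧ h w = 2 ∧ h x = 2)) ∧
  (h v = 1 →
    (∃ u, G.Adj v u ∧ 3 ≤ h u) ∨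
    (∃ u w, G.Adj v u ∧ G.Adj v w ∧ u ≠ w ∧ h u = 2 ∧ h w = 2)) ∧
  (h v = 2 → ∃ u, G.Adj v u ∧ 2 ≤ h u)

/-- The local condition survives relabelling vertices of label `0` other than `v`. -/
lemma LocalTRD.congr_of_ne_zero {V : Type*} {G : SimpleGraph V} {h h' : V → ℕ} {v : V}
    (hl : LocalTRD G h v) (hv : h' v = h v) (hne : ∀ u, h u ≠ 0 → h' u = h u) :
    LocalTRD G h' v := by
  obtain ⟨h4, h0, h1, h2⟩ := hl
  have key : ∀ u n, n ≠ 0 → h u = n → h' u = n := fun u n hn hu => by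
    rw [hne u (by omega), hu]
  have key' : ∀ u n, n ≠ 0 → n ≤ h u → n ≤ h' u := fun u n hn hu => by
    rw [hne u (by omega)]; exact hu
  refine ⟨by omega, fun h => ?_, fun h => ?_, fun h => ?_⟩
  · rcases h0 (by omega) with ⟨u, a, e⟩ | ⟨u, w, a, b, e, f⟩ |
      ⟨u, w, x, a, b, c, n1, n2, n3, e, f, g⟩
    · exact .inl ⟨u, a, key u 4 (by simp) e⟩
    · exact .inr (.inl ⟨u, w, a, b, key u 2 (by simp) e, key w 3 (by simp) f⟩)
    · exact .inr (.inr ⟨u, w, x, a, b, c, n1, n2, n3, key u 2 (by simp) e,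
        key w 2 (by simp) f, key x 2 (by simp) g⟩)
  · rcases h1 (by omega) with ⟨u, a, e⟩ | ⟨u, w, a, b, n, e, f⟩
    · exact .inl ⟨u, a, key' u 3 (by simp) e⟩
    · exact .inr ⟨u, w, a, b, n, key u 2 (by simp) e, key w 2 (by simp) f⟩
  · obtain ⟨u, a, e⟩ := h2 (by omega)
    exact ⟨u, a, key' u 2 (by simp) e⟩

/-- A vertex of label at least `3` satisfies the local condition. -/
lemma localTRD_of_three_le {V : Type*} {G : SimpleGraph V} {h : V → ℕ} {v : V}
    (h3 : 3 ≤ h v) (h4 : h v ≤ 4) : LocalTRD G h v :=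
  ⟨h4, by omega, by omega, by omega⟩

/-- A vertex of label `0` adjacent to a vertex of label `4` satisfies the local condition. -/
lemma localTRD_of_adj_four {V : Type*} {G : SimpleGraph V} {h : V → ℕ} {u v : V}
    (hv : h v = 0) (ha : G.Adj v u) (hu : h u = 4) : LocalTRD G h v :=
  ⟨by omega, fun _ => .inl ⟨u, ha, hu⟩, by omega, by omega⟩

/-- A vertex of label `2` adjacent to a vertex of label `2` satisfies the local condition. -/
lemma localTRD_of_adj_two {V : Type*} {G : SimpleGraph V} {h : V → ℕ} {u v : V}
    (hv : h v = 2) (ha : G.Adj v u) (hu : h u = 2) : LocalTRD G h v :=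
  ⟨by omega, by omega, by omega, fun _ => ⟨u, ha, hu.ge⟩⟩

/-- `S` carries a triple Roman dominating labelling, vanishing outside `S`, of weight at most
`7 / 4` times the size of `S`. -/
def HasLightTRD {V : Type*} (G : SimpleGraph V) (S : Finset V) : Prop :=
  ∃ h : V → ℕ, (∀ v, v ∉ S → h v = 0) ∧ (∀ v ∈ S, LocalTRD G h v) ∧
    4 * ∑ v ∈ S, h v ≤ 7 * #S

lemma HasLightTRD.union {V : Type*} [DecidableEq V] {G : SimpleGraph V} {S T : Finset V}
    (hS : HasLightTRD G S) (hT : HasLightTRD G T) (hST : Disjoint S T) :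
    HasLightTRD G (S ∪ T) := by
  obtain ⟨f, f0, fl, fw⟩ := hS
  obtain ⟨g, g0, gl, gw⟩ := hT
  have hgS : ∀ v ∈ S, g v = 0 := fun v hv => g0 v (Finset.disjoint_left.1 hST hv)
  have hfT : ∀ v ∈ T, f v = 0 := fun v hv => f0 v (Finset.disjoint_right.1 hST hv)
  refine ⟨fun v => f v + g v, fun v hv => ?_, fun v hv => ?_, ?_⟩
  · rw [Finset.notMem_union] at hv
    simp [f0 v hv.1, g0 v hv.2]
  · rcases Finset.mem_union.1 hv with hv | hv
    · refine (fl v hv).congr_of_ne_zero (by simp [hgS v hv]) fun u hu => ?_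
      have : u ∈ S := by
        by_contra hc
        exact hu (f0 u hc)
      simp [hgS u this]
    · refine (gl v hv).congr_of_ne_zero (by simp [hfT v hv]) fun u hu => ?_
      have : u ∈ T := by
        by_contra hc
        exact hu (g0 u hc)
      simp [hfT u this]
  · rw [Finset.sum_union hST, Finset.card_union_of_disjoint hST,
      Finset.sum_congr rfl (g := fun v => f v) fun v hv => by simp [hgS v hv],
      Finset.sum_congr (s₁ := T) rfl (g := fun v => g v) fun v hv => by simp [hfT v hv]]
    omega

/-- The star on three vertices. -/
lemma hasLightTRD_path_three {V : Type*} [DecidableEq V] {G : SimpleGraph V} {x y z : V}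
    (hx : G.Adj y x) (hz : G.Adj z x) (hyz : y ≠ z) :
    HasLightTRD G {x, y, z} := by
  have hyx := hx.ne
  have hzx := hz.ne
  refine ⟨fun v => if v = x then 4 else 0, fun v hv => ?_, fun v hv => ?_, ?_⟩
  · simp_all
  · simp only [Finset.mem_insert, Finset.mem_singleton] at hv
    rcases hv with rfl | rfl | rfl
    · exact localTRD_of_three_le (by simp) (by simp)
    · exact localTRD_of_adj_four (by simp [hyx]) hx (by simp)
    · exact localTRD_of_adj_four (by simp [hzx]) hz (by simp)
  · rw [Finset.card_eq_three.2 ⟨x, y, z, hyx.symm, hzx.symm, hyz, rfl⟩]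
    simp

/-- A path on five vertices, as a union of a path on three vertices centered at `x` and an
edge. -/
lemma hasLightTRD_path_five {V : Type*} [DecidableEq V] {G : SimpleGraph V} {x y z x' y' : V}
    (hx : G.Adj y x) (hz : G.Adj z x)
    (hyz : y ≠ z) (hxy' : G.Adj y' x') (hx' : x' ∉ ({x, y, z} : Finset V))
    (hy' : y' ∉ ({x, y, z} : Finset V)) :
    HasLightTRD G (insert x' (insert y' {x, y, z})) := by
  have hyx := hx.ne
  have hzx := hz.ne
  have hne := hxy'.ne
  simp only [Finset.mem_insert, Finset.mem_singleton, not_or] at hx' hy'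
  obtain ⟨h1, h2, h3⟩ := hx'
  obtain ⟨h4, h5, h6⟩ := hy'
  let h : V → ℕ := fun v => if v = x then 4 else if v = x' then 2 else if v = y' then 2 else 0
  have ex : h x = 4 := by simp [h]
  have ex' : h x' = 2 := by simp [h, h1]
  have ey' : h y' = 2 := by simp [h, h4]
  have ey : h y = 0 := by simp [h, hyx, Ne.symm h2, Ne.symm h5]
  have ez : h z = 0 := by simp [h, hzx, Ne.symm h3, Ne.symm h6]
  refine ⟨h, fun v hv => ?_, fun v hv => ?_, ?_⟩
  · simp only [Finset.mem_insert, Finset.mem_singleton, not_or] at hv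
    simp [h, hv.1, hv.2.1, hv.2.2.1]
  · simp only [Finset.mem_insert, Finset.mem_singleton] at hv
    rcases hv with rfl | rfl | rfl | rfl | rfl
    · exact localTRD_of_adj_two ex' hxy'.symm ey'
    · exact localTRD_of_adj_two ey' hxy' ex'
    · exact localTRD_of_three_le (by omega) (by omega)
    · exact localTRD_of_adj_four ey hx ex
    · exact localTRD_of_adj_four ez hz ex
  · rw [Finset.sum_insert (by simp [h1, h2, h3, hne.symm]), Finset.sum_insert (by simp [h4, h5, h6]),
      Finset.sum_insert (by simp [hyx.symm, hzx.symm]), Finset.sum_insert (by simp [hyz]),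
      Finset.sum_singleton, Finset.card_insert_of_notMem (by simp [h1, h2, h3, hne.symm]),
      Finset.card_insert_of_notMem (by simp [h4, h5, h6]),
      Finset.card_insert_of_notMem (by simp [hyx.symm, hzx.symm]),
      Finset.card_insert_of_notMem (by simp [hyz]), Finset.card_singleton, ex, ex', ey', ey, ez]
    norm_num

/-- `S` is spanned by a tree consisting of `a` legs of length one and `b` legs of length two,
all attached to the vertex `c`. -/
inductive IsSpider_s9 {V : Type*} [DecidableEq V] (G : SimpleGraph V) (c : V) :
    Finset V → ℕ → ℕ → Prop
  | center : IsSpider_s9 G c {c} 0 0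
  | short {S : Finset V} {a b : ℕ} {x : V} : IsSpider_s9 G c S a b → x ∉ S → G.Adj x c →
      IsSpider_s9 G c (insert x S) (a + 1) b
  | long {S : Finset V} {a b : ℕ} {x y : V} : IsSpider_s9 G c S a b → x ∉ S → y ∉ S → x ≠ y →
      G.Adj x c → G.Adj y x → IsSpider_s9 G c (insert x (insert y S)) a (b + 1)

namespace IsSpider_s9

variable {V : Type*} [DecidableEq V] {G : SimpleGraph V} {c : V} {S : Finset V} {a b : ℕ}

lemma center_mem (hS : IsSpider_s9 G c S a b) : c ∈ S := by
  induction hS with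
  | center => simp
  | short _ _ _ ih => simp [ih]
  | long _ _ _ _ _ _ ih => simp [ih]

lemma card_eq_s9 (hS : IsSpider_s9 G c S a b) : #S = 1 + a + 2 * b := by
  induction hS with
  | center => simp
  | short _ hx _ ih => rw [Finset.card_insert_of_notMem hx, ih]; omega
  | long _ hx hy hxy _ _ ih =>
    rw [Finset.card_insert_of_notMem (by simp [hx, hxy]), Finset.card_insert_of_notMem hy, ih]
    omega

lemma eq_singleton (hS : IsSpider_s9 G c S 0 0) : S = {c} := by
  cases hS
  rfl

/-- The labelling with `4` on the center and `3` on the ends of the long legs. -/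
lemma exists_label_center_four (hS : IsSpider_s9 G c S a b) :
    ∃ h : V → ℕ, (∀ v, v ∉ S → h v = 0) ∧ h c = 4 ∧ (∀ v ∈ S, LocalTRD G h v) ∧
      ∑ v ∈ S, h v = 4 + 3 * b := by
  induction hS with
  | center =>
    refine ⟨fun v => if v = c then 4 else 0, fun v hv => ?_, by simp, fun v hv => ?_, by simp⟩
    · simp_all
    · exact localTRD_of_three_le (by simp_all) (by simp_all)
  | @short S a b x hS hx hxc ih =>
    obtain ⟨h, h0, hc, hl, hw⟩ := ih
    refine ⟨h, fun v hv => h0 v (by simp_all), hc, fun v hv => ?_, ?_⟩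
    · rcases Finset.mem_insert.1 hv with rfl | hv
      · exact localTRD_of_adj_four (h0 _ hx) hxc hc
      · exact hl v hv
    · rw [Finset.sum_insert hx, h0 x hx, hw, zero_add]
  | @long S a b x y hS hx hy hxy hxc hyx ih =>
    obtain ⟨h, h0, hc, hl, hw⟩ := ih
    have hne : ∀ v ∈ S, v ≠ y := fun v hv e => hy (e ▸ hv)
    have hS' : ∀ v ∈ S, Function.update h y 3 v = h v := fun v hv => by simp [hne v hv]
    have hc' : Function.update h y 3 c = 4 := by rw [hS' c hS.center_mem, hc]
    have hx' : Function.update h y 3 x = 0 := by simp [hxy, h0 x hx]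
    refine ⟨Function.update h y 3, fun v hv => ?_, hc', fun v hv => ?_, ?_⟩
    · simp only [Finset.mem_insert, not_or] at hv
      simp [hv.2.1, h0 v hv.2.2]
    · simp only [Finset.mem_insert] at hv
      rcases hv with rfl | rfl | hv
      · exact localTRD_of_adj_four hx' hxc hc'
      · exact localTRD_of_three_le (by simp) (by simp)
      · refine (hl v hv).congr_of_ne_zero (hS' v hv) fun u hu => hS' u ?_
        by_contra hc
        exact hu (h0 u hc)
    · rw [Finset.sum_insert (by simp [hx, hxy]), Finset.sum_insert hy, hx',
        Finset.sum_congr rfl hS', hw, Function.update_self]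
      omega

/-- The labelling with `2` on the center and `3` on the ends of the long legs, of a spider all
of whose legs are long. The condition may fail at the center only. -/
lemma exists_label_center_two (hS : IsSpider_s9 G c S a b) (ha : a = 0) :
    ∃ h : V → ℕ, (∀ v, v ∉ S → h v = 0) ∧ h c = 2 ∧ (∀ v ∈ S, v ≠ c → LocalTRD G h v) ∧
      ∑ v ∈ S, h v = 2 + 3 * b := by
  induction hS with
  | center =>
    exact ⟨fun v => if v = c then 2 else 0, by simp_all, by simp, by simp_all, by simp⟩
  | short => omega
  | @long S a b x y hS hx hy hxy hxc hyx ih =>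
    obtain ⟨h, h0, hc, hl, hw⟩ := ih ha
    have hne : ∀ v ∈ S, v ≠ y := fun v hv e => hy (e ▸ hv)
    have hS' : ∀ v ∈ S, Function.update h y 3 v = h v := fun v hv => by simp [hne v hv]
    have hc' : Function.update h y 3 c = 2 := by rw [hS' c hS.center_mem, hc]
    have hx' : Function.update h y 3 x = 0 := by simp [hxy, h0 x hx]
    refine ⟨Function.update h y 3, fun v hv => ?_, hc', fun v hv hvc => ?_, ?_⟩
    · simp only [Finset.mem_insert, not_or] at hv
      simp [hv.2.1, h0 v hv.2.2]
    · simp only [Finset.mem_insert] at hv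
      rcases hv with rfl | rfl | hv
      · exact ⟨by omega, fun _ => .inr (.inl ⟨c, y, hxc, hyx.symm, hc', by simp⟩),
          by omega, by omega⟩
      · exact localTRD_of_three_le (by simp) (by simp)
      · refine (hl v hv hvc).congr_of_ne_zero (hS' v hv) fun u hu => hS' u ?_
        by_contra hc
        exact hu (h0 u hc)
    · rw [Finset.sum_insert (by simp [hx, hxy]), Finset.sum_insert hy, hx',
        Finset.sum_congr rfl hS', hw, Function.update_self]
      omega

lemma hasLightTRD (hS : IsSpider_s9 G c S a b) (h3 : 3 ≤ #S) : HasLightTRD G S := by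
  have hcard := hS.card_eq_s9
  obtain rfl | ha := Nat.eq_zero_or_pos a
  · cases hS with
    | center => simp at h3
    | @long S _ b x y hS hx hy hxy hxc hyx =>
      match b, hS with
      | 0, hS =>
        obtain rfl := hS.eq_singleton
        exact hasLightTRD_path_three hyx hxc.symm (by simpa using hy)
      | 1, hS =>
        cases hS with
        | @long S _ _ x' y' hS hx' hy' hxy' hxc' hyx' =>
          obtain rfl := hS.eq_singleton
          exact hasLightTRD_path_five hyx' hxc'.symm (by simpa using hy') hyx hx hy
      | b + 2, hS =>
        obtain ⟨h, h0, hc, hl, hw⟩ := hS.exists_label_center_two rfl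
        have hcS := hS.center_mem
        let h' : V → ℕ := Function.update (Function.update h x 2) y 2
        have hS' : ∀ v ∈ S, h' v = h v := fun v hv => by
          have h1 : v ≠ x := fun e => hx (e ▸ hv)
          have h2 : v ≠ y := fun e => hy (e ▸ hv)
          simp [h', h1, h2]
        have hx' : h' x = 2 := by simp [h', hxy]
        have hy' : h' y = 2 := by simp [h']
        have hc' : h' c = 2 := by rw [hS' c hcS, hc]
        refine ⟨h', fun v hv => ?_, fun v hv => ?_, ?_⟩
        · simp only [Finset.mem_insert, not_or] at hv
          simp [h', hv.1, hv.2.1, h0 v hv.2.2]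
        · simp only [Finset.mem_insert] at hv
          rcases hv with rfl | rfl | hv
          · exact localTRD_of_adj_two hx' hxc hc'
          · exact localTRD_of_adj_two hy' hyx hx'
          · by_cases hvc : v = c
            · subst hvc
              exact localTRD_of_adj_two hc' hxc.symm hx'
            · refine (hl v hv hvc).congr_of_ne_zero (hS' v hv) fun u hu => hS' u ?_
              by_contra hc
              exact hu (h0 u hc)
        · rw [hcard, Finset.sum_insert (by simp [hx, hxy]), Finset.sum_insert hy, hx', hy',
            Finset.sum_congr rfl hS', hw]
          omega
  · obtain ⟨h, h0, _, hl, hw⟩ := hS.exists_label_center_four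
    exact ⟨h, h0, hl, by omega⟩

end IsSpider_s9

/-- A finite set of vertices is joined in `G` if there is an edge across each of its proper
cuts. The empty set is allowed. -/
def Finset.IsJoined {V : Type*} [DecidableEq V] (G : SimpleGraph V) (S : Finset V) : Prop :=
  ∀ T ⊆ S, T.Nonempty → T ≠ S → ∃ u ∈ T, ∃ w ∈ S \ T, G.Adj u w

section IsJoined

variable {V : Type*} [DecidableEq V] {G : SimpleGraph V}

lemma isJoined_empty : IsJoined G ∅ := fun _ hT _ hT' =>
  absurd (Finset.subset_empty.1 hT) hT'

lemma isJoined_singleton (x : V) : IsJoined G {x} := by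
  intro T hT hne hT'
  rcases Finset.subset_singleton_iff.1 hT with rfl | rfl
  · simp at hne
  · simp at hT'

lemma Finset.IsJoined.union {C D : Finset V} (hC : IsJoined G C) (hD : IsJoined G D) {u w : V}
    (hu : u ∈ C) (hw : w ∈ D) (huw : G.Adj u w) : IsJoined G (C ∪ D) := by
  intro T hT hne hT'
  have cut : ∀ E : Finset V, IsJoined G E → E ⊆ C ∪ D → (∃ v ∈ E, v ∈ T) → (∃ v ∈ E, v ∉ T) →
      ∃ u ∈ T, ∃ w ∈ (C ∪ D) \ T, G.Adj u w := by
    rintro E hE hED ⟨v, hvE, hvT⟩ ⟨v', hvE', hvT'⟩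
    obtain ⟨p, hp, q, hq, hpq⟩ := hE (E ∩ T) Finset.inter_subset_left ⟨v, by simp [hvE, hvT]⟩
      fun e => hvT' (Finset.mem_inter.1 (e.symm ▸ hvE')).2
    simp only [Finset.mem_inter, Finset.mem_sdiff, not_and] at hp hq
    exact ⟨p, hp.2, q, Finset.mem_sdiff.2 ⟨hED hq.1, hq.2 hq.1⟩, hpq⟩
  by_cases h1 : (∃ v ∈ C, v ∈ T) ∧ ∃ v ∈ C, v ∉ T
  · exact cut C hC Finset.subset_union_left h1.1 h1.2
  by_cases h2 : (∃ v ∈ D, v ∈ T) ∧ ∃ v ∈ D, v ∉ T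
  · exact cut D hD Finset.subset_union_right h2.1 h2.2
  by_cases huT : u ∈ T <;> by_cases hwT : w ∈ T
  · refine absurd (Finset.Subset.antisymm hT fun v hv => ?_) hT'
    by_contra hvT
    rcases Finset.mem_union.1 hv with hv | hv
    · exact h1 ⟨⟨u, hu, huT⟩, v, hv, hvT⟩
    · exact h2 ⟨⟨w, hw, hwT⟩, v, hv, hvT⟩
  · exact ⟨u, huT, w, by simp [hw, hwT], huw⟩
  · exact ⟨w, hwT, u, by simp [hu, huT], huw.symm⟩
  · obtain ⟨v, hvT⟩ := hne
    rcases Finset.mem_union.1 (hT hvT) with hv | hv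
    · exact absurd ⟨⟨v, hv, hvT⟩, u, hu, huT⟩ h1
    · exact absurd ⟨⟨v, hv, hvT⟩, w, hw, hwT⟩ h2

lemma Finset.IsJoined.insert {C : Finset V} (hC : IsJoined G C) {u w : V}
    (hu : u ∈ C) (huw : G.Adj u w) : IsJoined G (insert w C) := by
  rw [Finset.insert_eq]
  exact (isJoined_singleton w).union hC (Finset.mem_singleton_self w) hu huw.symm

lemma isJoined_univ [Fintype V] (hG : G.Connected) : IsJoined G Finset.univ := by
  rintro T - ⟨u, hu⟩ hT'
  obtain ⟨w, hw⟩ : ∃ w, w ∉ T := by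
    by_contra! hc
    exact hT' (Finset.eq_univ_of_forall hc)
  obtain ⟨p⟩ := hG u w
  obtain ⟨d, -, h1, h2⟩ := p.exists_boundary_dart (T : Set V) (by simpa using hu) (by simpa using hw)
  exact ⟨d.fst, by simpa using h1, d.snd, by simpa using h2, d.adj⟩

/-- A joined set `A` with at least two vertices, one of which is `c`, has a joined subset that
avoids `c`, has a neighbour of `c`, and whose removal leaves `A` joined. -/
lemma Finset.IsJoined.exists_branch {A : Finset V} {c : V} (hA : IsJoined G A) (hc : c ∈ A)
    (hne : A ≠ {c}) :
    ∃ C ⊆ A, c ∉ C ∧ IsJoined G C ∧ IsJoined G (A \ C) ∧ ∃ u ∈ C, G.Adj u c := by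
  obtain ⟨p, hp, x, hx, hpx⟩ := hA {c} (by simpa using hc) (by simp) hne.symm
  obtain rfl := Finset.mem_singleton.1 hp
  simp only [Finset.mem_sdiff, Finset.mem_singleton] at hx
  have exists_max : ∀ (B : Finset V) (z : V), z ∈ B → ∃ C ⊆ B, z ∈ C ∧ IsJoined G C ∧
      ∀ u ∈ C, ∀ w ∈ B, w ∉ C → ¬ G.Adj u w := by
    classical
    intro B z hz
    obtain ⟨C, hC, hmax⟩ := (B.powerset.filter fun C => z ∈ C ∧ IsJoined G C).exists_max_image
      Finset.card ⟨{z}, by simp [hz, isJoined_singleton]⟩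
    simp only [Finset.mem_filter, Finset.mem_powerset] at hC hmax
    refine ⟨C, hC.1, hC.2.1, hC.2.2, fun u hu w hw hwC huw => ?_⟩
    have := hmax (Insert.insert w C)
      ⟨Finset.insert_subset hw hC.1, by simp [hC.2.1], hC.2.2.insert hu huw⟩
    rw [Finset.card_insert_of_notMem hwC] at this
    omega
  obtain ⟨C, hCA, hxC, hC, hCmax⟩ := exists_max (A.erase p) x (by simp [hx])
  have hpC : p ∉ C := fun h => by simpa using hCA h
  obtain ⟨D, hDA, hpD, hD, hDmax⟩ := exists_max (A \ C) p (by simp [hc, hpC])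
  refine ⟨C, hCA.trans (Finset.erase_subset _ _), hpC, hC, ?_, x, hxC, hpx.symm⟩
  suffices h : A \ C = D by rwa [h]
  by_contra hcon
  obtain ⟨w, hw, hwD⟩ : ∃ w ∈ A \ C, w ∉ D := by
    by_contra! h
    exact hcon (Finset.Subset.antisymm h hDA)
  rw [Finset.mem_sdiff] at hw
  obtain ⟨u, hu, v, hv, huv⟩ := hA (C ∪ D)
    (Finset.union_subset (hCA.trans (Finset.erase_subset _ _)) (hDA.trans Finset.sdiff_subset))
    ⟨p, by simp [hpD]⟩ fun e => by
      have := e.symm ▸ hw.1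
      simp [hw.2, hwD] at this
  simp only [Finset.mem_sdiff, Finset.mem_union, not_or] at hv
  rcases Finset.mem_union.1 hu with hu | hu
  · exact hCmax u hu v (Finset.mem_erase.2 ⟨fun e => hv.2.2 (e ▸ hpD), hv.1⟩) hv.2.1 huv
  · exact hDmax u hu v (Finset.mem_sdiff.2 ⟨hv.1, hv.2.1⟩) hv.2.2 huv

/-- A joined set with at most two vertices can be attached to a spider as a leg. -/
lemma IsSpider_s9.exists_union {S C : Finset V} {a b : ℕ} {c u : V} (hS : IsSpider_s9 G c S a b)
    (hC : IsJoined G C) (hSC : Disjoint S C) (hcard : #C ≤ 2) (hu : u ∈ C) (huc : G.Adj u c) :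
    ∃ a' b', IsSpider_s9 G c (S ∪ C) a' b' := by
  have huS : u ∉ S := Finset.disjoint_right.1 hSC hu
  by_cases hCu : C = {u}
  · subst hCu
    exact ⟨a + 1, b, by simpa [Finset.union_comm] using hS.short huS huc⟩
  · obtain ⟨u', hu', y, hy, huy⟩ := hC {u} (by simpa using hu) (by simp) (Ne.symm hCu)
    obtain rfl := Finset.mem_singleton.1 hu'
    rw [Finset.mem_sdiff] at hy
    have hCy : {u', y} = C := Finset.eq_of_subset_of_card_le
      (Finset.insert_subset hu (by simpa using hy.1)) (by rw [Finset.card_pair huy.ne]; exact hcard)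
    subst hCy
    refine ⟨a, b + 1, ?_⟩
    have := hS.long huS (Finset.disjoint_right.1 hSC hy.1) huy.ne huc huy.symm
    rwa [show S ∪ {u', y} = Insert.insert u' (Insert.insert y S) by ext; simp]

/-- If every joined subset avoiding `c` with joined complement in `A` has at most two vertices,
then `A` is spanned by a spider centered at `c`. -/
lemma Finset.IsJoined.exists_isSpider {c : V} (A : Finset V) (hA : IsJoined G A) (hc : c ∈ A)
    (hbr : ∀ C ⊆ A, c ∉ C → IsJoined G C → IsJoined G (A \ C) → #C ≤ 2) :
    ∃ a b, IsSpider_s9 G c A a b := by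
  induction A using Finset.strongInduction with
  | H A ih =>
    by_cases hAc : A = {c}
    · exact ⟨0, 0, hAc ▸ .center⟩
    obtain ⟨C, hCA, hcC, hC, hAC, u, hu, huc⟩ := hA.exists_branch hc hAc
    have hcAC : c ∈ A \ C := Finset.mem_sdiff.2 ⟨hc, hcC⟩
    obtain ⟨a, b, hs⟩ := ih (A \ C) (Finset.sdiff_ssubset hCA ⟨u, hu⟩) hAC hcAC
      fun C' hC'A hcC' hC' hAC' => hbr C' (hC'A.trans Finset.sdiff_subset) hcC' hC' (by
        have h := hAC'.union hC (Finset.mem_sdiff.2 ⟨hcAC, hcC'⟩) hu huc.symm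
        have hdis : ∀ v ∈ C, v ∉ C' := fun v hv hv' => (Finset.mem_sdiff.1 (hC'A hv')).2 hv
        rwa [show A \ C' = (A \ C) \ C' ∪ C by
          ext v
          have := hdis v
          have := @hCA v
          simp only [Finset.mem_sdiff, Finset.mem_union]
          tauto])
    have := hs.exists_union hC Finset.sdiff_disjoint (hbr C hCA hcC hC hAC) hu huc
    rwa [Finset.sdiff_union_of_subset hCA] at this

/-- Every joined set with at least three vertices has a light triple Roman dominating
labelling. -/
lemma Finset.IsJoined.hasLightTRD (W : Finset V) (hW : IsJoined G W) (h3 : 3 ≤ #W) :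
    HasLightTRD G W := by
  classical
  induction W using Finset.strongInduction with
  | H W ih =>
    obtain ⟨S, hS, hmin⟩ := (W.powerset.filter fun S =>
      3 ≤ #S ∧ IsJoined G S ∧ IsJoined G (W \ S)).exists_min_image Finset.card
        ⟨W, by simp [h3, hW, isJoined_empty]⟩
    simp only [Finset.mem_filter, Finset.mem_powerset] at hS hmin
    obtain ⟨hSW, hS3, hSj, hWS⟩ := hS
    have spider : ∀ c ∈ S, (W = S ∨ ∃ u ∈ W \ S, G.Adj u c) → ∃ a b, IsSpider_s9 G c S a b := by
      intro c hc hcu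
      refine hSj.exists_isSpider S hc fun C hCS hcC hC hSC => ?_
      by_contra! hlt
      have hWC : IsJoined G (W \ C) := by
        rcases hcu with rfl | ⟨u, hu, huc⟩
        · exact hSC
        · have h := hSC.union hWS (Finset.mem_sdiff.2 ⟨hc, hcC⟩) hu huc.symm
          rwa [show W \ C = S \ C ∪ W \ S by
            ext v
            have := @hSW v
            have := @hCS v
            simp only [Finset.mem_sdiff, Finset.mem_union]
            tauto]
      have h1 := hmin C ⟨hCS.trans hSW, hlt, hC, hWC⟩
      have h2 := Finset.card_lt_card (hCS.ssubset_of_ne fun e => hcC (e ▸ hc))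
      omega
    have hSne : S.Nonempty := Finset.card_pos.1 (by omega)
    by_cases hSeq : S = W
    · obtain ⟨c, hc⟩ := hSne
      obtain ⟨a, b, hs⟩ := spider c hc (.inl hSeq.symm)
      exact hSeq ▸ hs.hasLightTRD hS3
    · obtain ⟨c, hc, u, hu, hcu⟩ := hW S hSW hSne hSeq
      obtain ⟨a, b, hs⟩ := spider c hc (.inr ⟨u, hu, hcu.symm⟩)
      rw [← Finset.union_sdiff_of_subset hSW]
      rcases Nat.lt_or_ge 2 #(W \ S) with hlt | hle
      · exact (hs.hasLightTRD hS3).union (ih _ (Finset.sdiff_ssubset hSW hSne) hWS hlt)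
          Finset.disjoint_sdiff
      · obtain ⟨a', b', hs'⟩ := hs.exists_union hWS Finset.disjoint_sdiff hle hu hcu.symm
        exact hs'.hasLightTRD (by rwa [Finset.union_sdiff_of_subset hSW])

end IsJoined

/-- If `Γ` is a nontrivial connected graph of order `p ≥ 3`, then `γ_[3R](Γ) ≤ 7p/4`. -/
theorem tripleRoman_le_seven_fourths {V : Type*} [Fintype V] (G : SimpleGraph V) (p : ℕ)
    (hp : Fintype.card V = p) (hconn : G.Connected) (hp3 : 3 ≤ p) :
    (tripleRomanNumber G : ℚ) ≤ 7 * p / 4 := by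
  classical
  obtain ⟨h, -, hl, hw⟩ := (isJoined_univ hconn).hasLightTRD Finset.univ
    (by rwa [Finset.card_univ, hp])
  rw [Finset.card_univ, hp] at hw
  have hle : tripleRomanNumber G ≤ ∑ v, h v := Nat.sInf_le ⟨h,
    ⟨fun v => (hl v (Finset.mem_univ v)).1, fun v => (hl v (Finset.mem_univ v)).2.1,
      fun v => (hl v (Finset.mem_univ v)).2.2.1, fun v => (hl v (Finset.mem_univ v)).2.2.2⟩, rfl⟩
  have hq : (4 * tripleRomanNumber G : ℚ) ≤ 7 * p := by exact_mod_cast (by omega)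
  linarith
end

section
/- For every integer p ≥ 2, the triple Roman domination number of the path P_p on p vertices equals M_p, where M_p = 4⌊p/3⌋ if p ≡ 0 (mod 3), M_p = 4⌊p/3⌋ + 3 if p ≡ 1 (mod 3), and M_p = 4⌊p/3⌋ + 4 if p ≡ 2 (mod 3). -/
open SimpleGraph Finset

/-- The conditions for a triple Roman dominating function at a vertex labelled `b` whose two
neighbours on a path are labelled `a` and `c`, a missing neighbour counting as label `0`. -/
def PathLocal (a b c : ℕ) : Prop :=
  (b = 0 → a = 4 ∨ c = 4 ∨ (a = 2 ∧ c = 3) ∨ (a = 3 ∧ c = 2)) ∧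
  (b = 1 → 3 ≤ a ∨ 3 ≤ c ∨ (a = 2 ∧ c = 2)) ∧
  (b = 2 → 2 ≤ a ∨ 2 ≤ c)

instance (a b c : ℕ) : Decidable (PathLocal a b c) := by
  unfold PathLocal; infer_instance

/-- A lower bound for the excess over `4 * (n / 3)` of the weight of the first `n` vertices of a
path, where `n % 3 = r` and the last two of these vertices have labels `a` and `b`. -/
def prefixExcess (r : Fin 3) : Fin 5 → Fin 5 → ℕ :=
  ![![![0, 1, 1, 2, 3], ![0, 1, 2, 3, 4], ![0, 1, 2, 3, 4], ![0, 1, 2, 3, 4], ![0, 1, 2, 3, 4]],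
    ![![0, 1, 2, 3, 4], ![1, 2, 3, 4, 5], ![2, 3, 3, 4, 5], ![2, 3, 4, 5, 6], ![3, 4, 5, 6, 7]],
    ![![3, 4, 4, 5, 4], ![3, 4, 5, 4, 5], ![3, 4, 4, 5, 6], ![3, 4, 5, 6, 7], ![4, 5, 6, 7, 8]]] r

set_option maxRecDepth 10000 in
lemma prefixExcess_step : ∀ (r : Fin 3) (a b c : Fin 5), PathLocal a b c →
    prefixExcess (r + 1) b c + (if r = 2 then 4 else 0) ≤ prefixExcess r a b + c := by
  decide

lemma prefixExcess_one : ∀ b : Fin 5, prefixExcess 1 0 b ≤ b := by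
  decide

lemma le_prefixExcess_of_end : ∀ (r : Fin 3) (a b : Fin 5), PathLocal a b 0 →
    (if (r : ℕ) = 0 then 0 else if (r : ℕ) = 1 then 3 else 4) ≤ prefixExcess r a b := by
  decide

lemma prefixExcess_le_sum (p : ℕ) (f : ℕ → Fin 5) (h0 : f 0 = 0)
    (hf : ∀ i < p, PathLocal (f i) (f (i + 1)) (f (i + 2))) (n : ℕ) (hn : n < p) :
    4 * ((n + 1) / 3) + prefixExcess ⟨(n + 1) % 3, Nat.mod_lt _ (by norm_num)⟩ (f n) (f (n + 1))
      ≤ ∑ i ∈ range (n + 1), (f (i + 1) : ℕ) := by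
  induction n with
  | zero => simpa [h0] using prefixExcess_one (f 1)
  | succ n ih =>
    have ih := ih (by omega)
    have step := prefixExcess_step ⟨(n + 1) % 3, Nat.mod_lt _ (by norm_num)⟩ _ _ _
      (hf n (by omega))
    have hr : (⟨(n + 1) % 3, Nat.mod_lt _ (by norm_num)⟩ : Fin 3) + 1 =
        ⟨(n + 1 + 1) % 3, Nat.mod_lt _ (by norm_num)⟩ := by
      ext
      simp [Fin.val_add]
    rw [hr] at step
    rw [sum_range_succ]
    rw [show n + 1 + 1 = n + 2 from rfl] at *
    simp only [Fin.ext_iff, Fin.val_two] at step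
    split_ifs at step <;> omega

lemma pathGraph_weight_lower_bound (p : ℕ) (hp : 0 < p) (h : Fin p → ℕ)
    (hh : IsTRDF (SimpleGraph.pathGraph p) h) :
    (if p % 3 = 0 then 4 * (p / 3)
      else if p % 3 = 1 then 4 * (p / 3) + 3
      else 4 * (p / 3) + 4) ≤ ∑ v, h v := by
  obtain ⟨hle, hzero, hone, htwo⟩ := hh
  let f : ℕ → Fin 5 := fun i =>
    if hi : 0 < i ∧ i ≤ p then ⟨h ⟨i - 1, by omega⟩, by have := hle ⟨i - 1, by omega⟩; omega⟩ else 0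
  have hval : ∀ v : Fin p, (f (v + 1) : ℕ) = h v := by
    intro v
    have : (v : ℕ) + 1 ≤ p := v.2
    simp [f, this]
  have hnext : ∀ i (hi : i < p) (u : Fin p), (pathGraph p).Adj ⟨i, hi⟩ u →
      (u : ℕ) = i + 1 ∧ h u = f (i + 2) ∨ (u : ℕ) + 1 = i ∧ h u = f i := by
    intro i hi u hu
    rw [pathGraph_adj] at hu
    rcases hu with hu | hu
    · left
      refine ⟨hu.symm, ?_⟩
      rw [← hval u]
      simp at hu
      rw [← hu]
    · right
      refine ⟨hu, ?_⟩
      rw [← hval u]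
      simp at hu
      rw [hu]
  have hloc : ∀ i < p, PathLocal (f i) (f (i + 1)) (f (i + 2)) := by
    intro i hi
    have hv := hval ⟨i, hi⟩
    simp only at hv
    rw [hv]
    refine ⟨fun hb => ?_, fun hb => ?_, fun hb => ?_⟩
    · rcases hzero _ hb with ⟨u, hu, h1⟩ | ⟨u, w, hu, hw, h1, h2⟩ |
        ⟨u, w, x, hu, hw, hx, huw, hux, hwx, -⟩
      · have := hnext i hi u hu
        omega
      · have := hnext i hi u hu
        have := hnext i hi w hw
        rcases this with ⟨_, _⟩ | ⟨_, _⟩ <;> rcases hnext i hi u hu with ⟨_, _⟩ | ⟨_, _⟩ <;> omega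
      · have := hnext i hi u hu
        have := hnext i hi w hw
        have := hnext i hi x hx
        rw [ne_eq, Fin.ext_iff] at huw hux hwx
        omega
    · rcases hone _ hb with ⟨u, hu, h1⟩ | ⟨u, w, hu, hw, huw, h1, h2⟩
      · have := hnext i hi u hu
        omega
      · have := hnext i hi u hu
        have := hnext i hi w hw
        rw [ne_eq, Fin.ext_iff] at huw
        omega
    · obtain ⟨u, hu, h1⟩ := htwo _ hb
      have := hnext i hi u hu
      omega
  have hsum : ∑ v, h v = ∑ i ∈ range p, (f (i + 1) : ℕ) := by
    rw [← Fin.sum_univ_eq_sum_range (fun i => (f (i + 1) : ℕ))]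
    exact sum_congr rfl fun v _ => (hval v).symm
  obtain ⟨n, rfl⟩ : ∃ n, p = n + 1 := ⟨p - 1, by omega⟩
  have key := prefixExcess_le_sum (n + 1) f (by simp [f]) hloc n (by omega)
  have hend := hloc n (by omega)
  have hlast : f (n + 2) = 0 := by simp [f]
  rw [hlast] at hend
  have hfin := le_prefixExcess_of_end ⟨(n + 1) % 3, Nat.mod_lt _ (by norm_num)⟩ _ _ hend
  rw [hsum]
  simp only at hfin
  split_ifs at hfin ⊢ <;> omega

/-- The labelling of the path on `p` vertices that repeats `0, 4, 0`, with the last label replaced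
by `3` when `p % 3 = 1`. -/
def pathLabelling (p i : ℕ) : ℕ :=
  if i % 3 = 1 then 4 else if p % 3 = 1 ∧ i + 1 = p then 3 else 0

lemma sum_pathLabelling (p n : ℕ) (hn : n ≤ p) :
    ∑ i ∈ range n, pathLabelling p i =
      4 * ((n + 1) / 3) + if p % 3 = 1 ∧ 0 < n ∧ n = p then 3 else 0 := by
  induction n with
  | zero => simp
  | succ n ih =>
    rw [sum_range_succ, ih (by omega), pathLabelling]
    split_ifs <;> omega

lemma isTRDF_pathLabelling (p : ℕ) :
    IsTRDF (SimpleGraph.pathGraph p) fun v => pathLabelling p v := by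
  refine ⟨fun v => ?_, fun v hv => Or.inl ?_, fun v hv => ?_, fun v hv => ?_⟩ <;>
    simp only [pathLabelling] at *
  · split_ifs <;> omega
  · have hlt := v.2
    have h3 : (v : ℕ) % 3 ≠ 1 ∧ ¬ (p % 3 = 1 ∧ (v : ℕ) + 1 = p) := by
      split_ifs at hv
      exact ⟨‹_›, ‹_›⟩
    by_cases h0 : (v : ℕ) % 3 = 0
    · refine ⟨⟨v + 1, by omega⟩, ?_, ?_⟩
      · simp [pathGraph_adj]
      · exact if_pos (by simp only; omega)
    · refine ⟨⟨v - 1, by omega⟩, ?_, ?_⟩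
      · simp only [pathGraph_adj]; omega
      · exact if_pos (by simp only; omega)
  · split_ifs at hv <;> omega
  · split_ifs at hv <;> omega

/-- For every `p ≥ 2`, `γ_[3R](P_p) = M_p`, where `M_p = 4⌊p/3⌋` if `p ≡ 0 (mod 3)`,
`M_p = 4⌊p/3⌋ + 3` if `p ≡ 1 (mod 3)`, and `M_p = 4⌊p/3⌋ + 4` if `p ≡ 2 (mod 3)`. -/
theorem tripleRoman_path (p : ℕ) (hp : 2 ≤ p) :
    tripleRomanNumber (SimpleGraph.pathGraph p) =
      if p % 3 = 0 then 4 * (p / 3)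
      else if p % 3 = 1 then 4 * (p / 3) + 3
      else 4 * (p / 3) + 4 := by
  refine IsLeast.csInf_eq ⟨⟨_, isTRDF_pathLabelling p, ?_⟩, ?_⟩
  · rw [Fin.sum_univ_eq_sum_range, sum_pathLabelling p p le_rfl]
    split_ifs <;> omega
  · rintro w ⟨h, hh, rfl⟩
    exact pathGraph_weight_lower_bound p (by omega) h hh
end

section
/- Let Γ be a nontrivial connected simple graph with p vertices and diameter diam(Γ). Then γ_{[3R]}(Γ) ≤ 3p − (5·diam(Γ))/3 + 7/3. -/
open SimpleGraph Finset

/-- Labels `0, 4, 0, 0, 4, 0, …` for a path on `n` vertices, with label `3` on the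
at most two vertices left over at the end. -/
def pathLabel (n i : ℕ) : ℕ :=
  if n ≤ 3 * (i / 3) + 2 then 3 else if i % 3 = 1 then 4 else 0

theorem sum_pathLabel_le (n : ℕ) : 3 * ∑ i ∈ range n, pathLabel n i ≤ 4 * n + 12 := by
  have periodic : ∀ k, ∑ i ∈ range (3 * k), (if i % 3 = 1 then 4 else 0) = 4 * k := by
    intro k
    induction k with
    | zero => simp
    | succ k ih =>
      rw [show 3 * (k + 1) = 3 * k + 1 + 1 + 1 by ring, sum_range_succ, sum_range_succ,
        sum_range_succ, ih, if_neg (by lia), if_pos (by lia), if_neg (by lia)]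
      ring
  have initial : ∀ k r, ∑ i ∈ range (3 * k), pathLabel (3 * k + r) i = 4 * k := by
    intro k r
    rw [← periodic k]
    refine sum_congr rfl fun i hi => if_neg ?_
    have := mem_range.1 hi
    lia
  have le_four : ∀ i, pathLabel n i ≤ 4 := by
    intro i; unfold pathLabel; split_ifs <;> lia
  obtain ⟨k, r, hr, rfl⟩ : ∃ k r, r < 3 ∧ n = 3 * k + r := ⟨n / 3, n % 3, by lia, by lia⟩
  have h₀ := initial k r
  interval_cases r
  · simp only [add_zero] at h₀ ⊢
    lia
  · have := le_four (3 * k)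
    rw [sum_range_succ, h₀]
    lia
  · have h₁ : pathLabel (3 * k + 2) (3 * k) = 3 := if_pos (by lia)
    have h₂ : pathLabel (3 * k + 2) (3 * k + 1) = 3 := if_pos (by lia)
    rw [show range (3 * k + 2) = range (3 * k + 1 + 1) from rfl, sum_range_succ,
      sum_range_succ, h₀, h₁, h₂]
    lia

theorem exists_adj_pathLabel {n i : ℕ} (h : pathLabel n i = 0) :
    ∃ j < n, (j = i + 1 ∨ i = j + 1) ∧ pathLabel n j = 4 := by
  unfold pathLabel at h
  split_ifs at h with h₁ h₂
  have : pathLabel n (3 * (i / 3) + 1) = 4 := by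
    rw [pathLabel, if_neg (by lia), if_pos (by lia)]
  exact ⟨3 * (i / 3) + 1, by lia, by lia, this⟩

theorem isTRDF_extend_pathLabel {V : Type*} {G : SimpleGraph V} {n : ℕ} {f : Fin n → V}
    (hf : f.Injective) (hadj : ∀ i j : Fin n, (j : ℕ) = i + 1 → G.Adj (f i) (f j)) :
    IsTRDF G (Function.extend f (fun i => pathLabel n i) fun _ => 3) := by
  set h := Function.extend f (fun i => pathLabel n i) fun _ => 3
  have label : ∀ v, h v = 3 ∨ h v = 4 ∨ h v = 0 ∧ ∃ u, G.Adj v u ∧ h u = 4 := by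
    intro v
    by_cases hv : ∃ i, f i = v
    · obtain ⟨i, rfl⟩ := hv
      have hi : h (f i) = pathLabel n i := hf.extend_apply _ _ _
      by_cases h0 : pathLabel n i = 0
      · obtain ⟨j, hj, hij, h4⟩ := exists_adj_pathLabel h0
        refine .inr (.inr ⟨hi.trans h0, f ⟨j, hj⟩, ?_, (hf.extend_apply _ _ _).trans h4⟩)
        rcases hij with hij | hij
        · exact hadj _ _ hij
        · exact (hadj ⟨j, hj⟩ i hij).symm
      · rw [hi]
        unfold pathLabel at h0 ⊢
        split_ifs at h0 ⊢ <;> simp_all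
    · exact .inl (Function.extend_apply' _ _ _ hv)
  refine ⟨fun v => ?_, fun v hv => .inl ?_, fun v hv => ?_, fun v hv => ?_⟩ <;>
    rcases label v with h₁ | h₁ | ⟨h₁, h₂⟩ <;> first | lia | exact h₂

theorem tripleRomanNumber_le_of_path {V : Type*} [Fintype V] {G : SimpleGraph V} {n : ℕ}
    {f : Fin n → V} (hf : f.Injective)
    (hadj : ∀ i j : Fin n, (j : ℕ) = i + 1 → G.Adj (f i) (f j)) :
    3 * tripleRomanNumber G + 5 * n ≤ 9 * Fintype.card V + 12 := by
  classical
  have hle := Nat.sInf_le (s := {w | ∃ h : V → ℕ, IsTRDF G h ∧ ∑ v, h v = w})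
    ⟨_, isTRDF_extend_pathLabel hf hadj, rfl⟩
  change tripleRomanNumber G ≤ _ at hle
  rw [← sum_add_sum_compl (univ.image f), sum_image hf.injOn,
    sum_congr rfl fun i _ => hf.extend_apply _ _ i,
    Fin.sum_univ_eq_sum_range (pathLabel n) n,
    sum_congr (s₁ := (univ.image f)ᶜ) rfl fun v hv =>
      Function.extend_apply' (f := f) (fun i => pathLabel n i) (fun _ => 3) v (by simpa using hv),
    sum_const, card_compl, card_image_of_injective _ hf, card_fin, smul_eq_mul] at hle
  have hcard := Fintype.card_le_of_injective f hf
  rw [Fintype.card_fin] at hcard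
  have := sum_pathLabel_le n
  lia

/-- For a nontrivial connected graph `Γ` with `p` vertices and diameter `diam(Γ)`,
`γ_[3R](Γ) ≤ 3p - 5·diam(Γ)/3 + 7/3`. -/
theorem tripleRoman_le_of_diam {V : Type*} [Fintype V] (G : SimpleGraph V) (p : ℕ)
    (hp : Fintype.card V = p) (hconn : G.Connected) (hnt : 2 ≤ p) :
    (tripleRomanNumber G : ℚ) ≤ 3 * p - 5 * G.diam / 3 + 7 / 3 := by
  have : Nonempty V := hconn.nonempty
  obtain ⟨u, v, huv⟩ := G.exists_dist_eq_diam
  obtain ⟨w, hw, hlen⟩ := hconn.exists_path_of_dist u v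
  have key := tripleRomanNumber_le_of_path (G := G) (n := G.diam + 1)
    (f := fun i => w.getVert i)
    (fun i j hij => Fin.ext <| hw.getVert_injOn
      (by simp only [Set.mem_ofPred_eq]; lia) (by simp only [Set.mem_ofPred_eq]; lia) hij)
    (fun i j hij => by
      simp only [hij]
      exact w.adj_getVert_succ (by lia))
  rw [hp] at key
  have key' : (3 * tripleRomanNumber G + 5 * (G.diam + 1) : ℚ) ≤ 9 * p + 12 := by
    exact_mod_cast key
  linarith
end
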